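/- Let G be a graph on N = 2n vertices (n ≥ 4511) that contains no K_{2,n} and whose complement contains no cycle of length m, for a fixed even m with n+1 ≤ m ≤ 2n−4008. Then the minimum degree of the complement satisfies δ(Ḡ) ≥ ⌈n/2⌉ + 250. -/

import Mathlib

open SimpleGraph

/-- `G` contains `H` as a (not necessarily induced) subgraph. -/
def Contains {V W : Type*} (G : SimpleGraph V) (H : SimpleGraph W) : Prop :=
  ∃ f : H →g G, Function.Injective f

/-- `G` has a cycle with `m` vertices (equivalently, of length `m`). -/
def HasCycleLength {V : Type*} (G : SimpleGraph V) (m : ℕ) : Prop :=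
  ∃ (v : V) (c : G.Walk v v), c.IsCycle ∧ c.length = m

/-- The Ramsey property for `K_{a,b}` versus the cycle `C_m`: every graph `Γ` on `N` vertices
contains `K_{a,b}`, or its complement contains a cycle of length `m`. -/
def RamseyProp (a b m N : ℕ) : Prop :=
  ∀ Γ : SimpleGraph (Fin N),
    Contains Γ (completeBipartiteGraph (Fin a) (Fin b)) ∨ HasCycleLength Γᶜ m

/-- `G` is `k`-connected. -/
def IsKConnected {V : Type*} [Fintype V] (k : ℕ) (G : SimpleGraph V) : Prop :=
  k < Fintype.card V ∧
    ∀ S : Finset V, S.card < k → (G.induce ((↑S : Set V)ᶜ)).Connected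

/-- The circumference of `G`: the length of a longest cycle. -/
noncomputable def circumference {V : Type*} (G : SimpleGraph V) : ℕ :=
  sSup {m | HasCycleLength G m}

section Lists

variable {V : Type*}

/-- `l` is a chain of `H`-adjacent vertices from `a` to `b`. -/
def ChainFromTo (H : SimpleGraph V) (a b : V) (l : List V) : Prop :=
  l.IsChain H.Adj ∧ l.head? = some a ∧ l.getLast? = some b

/-- `c` lists the vertices of a closed chain without repetition. -/
def IsCyc (H : SimpleGraph V) (c : List V) : Prop :=
  c.Nodup ∧ ∃ a b, ChainFromTo H a b c ∧ H.Adj b a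

namespace ChainFromTo

variable {H : SimpleGraph V} {a b c d : V} {l l' : List V}

theorem ne_nil (h : ChainFromTo H a b l) : l ≠ [] := by
  rintro rfl; simpa using h.2.1

theorem single (H : SimpleGraph V) (a : V) : ChainFromTo H a a [a] := by
  simp [ChainFromTo]

theorem append (h : ChainFromTo H a b l) (h' : ChainFromTo H c d l') (hbc : H.Adj b c) :
    ChainFromTo H a d (l ++ l') := by
  refine ⟨List.isChain_append.2 ⟨h.1, h'.1, ?_⟩, ?_, ?_⟩
  · rw [h.2.2, h'.2.1]; simpa using hbc
  · simp [List.head?_append, h.2.1]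
  · simp [List.getLast?_append, h'.2.2]

theorem cons (h : ChainFromTo H c d l) (hbc : H.Adj b c) : ChainFromTo H b d (b :: l) :=
  (single H b).append h hbc

theorem rev (h : ChainFromTo H a b l) : ChainFromTo H b a l.reverse := by
  refine ⟨List.isChain_reverse.2 (h.1.imp fun _ _ h => h.symm), ?_, ?_⟩
  · simp [h.2.2]
  · simp [h.2.1]

theorem mono {K : SimpleGraph V} (hHK : H ≤ K) (h : ChainFromTo H a b l) : ChainFromTo K a b l :=
  ⟨h.1.imp fun _ _ h => hHK h, h.2⟩

theorem of_isChain (h : l.IsChain H.Adj) (hl : l ≠ []) :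
    ChainFromTo H (l.head hl) (l.getLast hl) l :=
  ⟨h, by simp [List.head?_eq_some_head hl], by simp [List.getLast?_eq_some_getLast hl]⟩

theorem left_mem (h : ChainFromTo H a b l) : a ∈ l := List.mem_of_mem_head? (by simp [h.2.1])

theorem right_mem (h : ChainFromTo H a b l) : b ∈ l := List.mem_of_getLast? h.2.2

end ChainFromTo

theorem IsCyc.hasCycleLength {H : SimpleGraph V} {l : List V} (h : IsCyc H l) (h3 : 3 ≤ l.length) :
    HasCycleLength H l.length := by
  obtain ⟨hn, a, b, ⟨hc, ha, hb⟩, hab⟩ := h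
  apply (cycleGraph_isContained_iff (G := H) (n := l.length) (by omega)).1
  obtain ⟨k, hk⟩ : ∃ k, l.length = k + 1 := ⟨l.length - 1, by omega⟩
  have key : ∀ i j : Fin l.length, (j.val = i.val + 1 ∨ (i.val + 1 = l.length ∧ j.val = 0)) →
      H.Adj l[i.val] l[j.val] := by
    intro i j hij
    rcases hij with h | ⟨h1, h2⟩
    · simp only [h]
      exact List.isChain_iff_getElem.1 hc i.val (by omega)
    · have e1 : l[i.val] = b := by
        rw [List.getLast?_eq_getElem?] at hb
        have : i.val = l.length - 1 := by omega
        grind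
      have e2 : l[j.val] = a := by
        rw [List.head?_eq_getElem?] at ha
        grind
      rw [e1, e2]; exact hab
  have step : ∀ i j : Fin l.length, (i - j).val = 1 → H.Adj l[j.val] l[i.val] := by
    intro i j hij
    apply key
    have hi := i.2
    have hj := j.2
    rw [Fin.sub_def] at hij
    simp only at hij
    by_cases hle : l.length - j.val + i.val < l.length
    · rw [Nat.mod_eq_of_lt hle] at hij; omega
    · rw [Nat.mod_eq_sub_mod (by omega), Nat.mod_eq_of_lt (by omega)] at hij; omega
  refine ⟨⟨⟨fun i => l[i.val], ?_⟩, ?_⟩⟩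
  · intro i j hij
    rcases cycleGraph_adj'.1 hij with h | h
    · exact (step _ _ h).symm
    · exact step _ _ h
  · intro i j hij
    exact Fin.ext ((List.Nodup.getElem_inj_iff hn).1 hij)

theorem IsCyc.mono {H K : SimpleGraph V} {c : List V} (hHK : H ≤ K) (h : IsCyc H c) : IsCyc K c :=
  let ⟨hn, a, b, h1, h2⟩ := h
  ⟨hn, a, b, h1.mono hHK, hHK h2⟩

theorem IsCyc.reverse {H : SimpleGraph V} {c : List V} (h : IsCyc H c) : IsCyc H c.reverse :=
  let ⟨hn, a, b, h1, h2⟩ := h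
  ⟨List.nodup_reverse.2 hn, b, a, h1.rev, h2.symm⟩

theorem IsCyc.rotate {H : SimpleGraph V} {s t : List V} (h : IsCyc H (s ++ t)) :
    IsCyc H (t ++ s) := by
  rcases eq_or_ne s [] with rfl | hs
  · simpa using h
  rcases eq_or_ne t [] with rfl | ht
  · simpa using h
  obtain ⟨hn, a, b, ⟨hc, ha, hb⟩, hab⟩ := h
  obtain ⟨h1, h2, h3⟩ := List.isChain_append.1 hc
  refine ⟨(List.perm_append_comm.nodup_iff).1 hn, t.head ht, s.getLast hs,
    (ChainFromTo.of_isChain h2 ht).append (ChainFromTo.of_isChain h1 hs) ?_, ?_⟩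
  · have e1 : t.getLast ht = b := by
      rw [List.getLast?_append, List.getLast?_eq_some_getLast ht] at hb; simpa using hb
    have e2 : s.head hs = a := by
      rw [List.head?_append, List.head?_eq_some_head hs] at ha; simpa using ha
    rw [e1, e2]; exact hab
  · exact h3 _ (by simp [List.getLast?_eq_some_getLast hs]) _ (by simp [List.head?_eq_some_head ht])

section Seg

variable {H : SimpleGraph V}

/-- The list `f i, …, f (j - 1)`. -/
def seg (f : ℕ → V) (i j : ℕ) : List V := (List.range' i (j - i)).map f

@[simp]
theorem length_seg (f : ℕ → V) (i j : ℕ) : (seg f i j).length = j - i := by simp [seg]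

theorem mem_seg {f : ℕ → V} {i j : ℕ} {x : V} : x ∈ seg f i j ↔ ∃ k, i ≤ k ∧ k < j ∧ f k = x := by
  simp only [seg, List.mem_map, List.mem_range'_1]
  constructor
  · rintro ⟨k, h, rfl⟩; exact ⟨k, by omega, by omega, rfl⟩
  · rintro ⟨k, h1, h2, rfl⟩; exact ⟨k, by omega, rfl⟩

theorem seg_append (f : ℕ → V) {i j k : ℕ} (hij : i ≤ j) (hjk : j ≤ k) :
    seg f i j ++ seg f j k = seg f i k := by
  rw [seg, seg, seg, ← List.map_append]
  congr 1
  have := List.range'_append (s := i) (m := j - i) (n := k - j) (step := 1)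
  rw [show i + 1 * (j - i) = j by omega] at this
  rw [this]; congr 1; omega

theorem chainFromTo_seg {f : ℕ → V} {i j : ℕ} (hij : i < j)
    (hf : ∀ k, i ≤ k → k + 1 < j → H.Adj (f k) (f (k + 1))) :
    ChainFromTo H (f i) (f (j - 1)) (seg f i j) := by
  obtain ⟨d, rfl⟩ : ∃ d, j = i + d + 1 := ⟨j - i - 1, by omega⟩
  induction d with
  | zero => simpa [seg] using ChainFromTo.single H (f i)
  | succ d ih =>
    have h1 := ih (by omega) fun k h1 h2 => hf k h1 (by omega)
    rw [← seg_append f (j := i + d + 1) (by omega) (by omega)]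
    have h2 : seg f (i + d + 1) (i + (d + 1) + 1) = [f (i + d + 1)] := by
      simp [seg, show i + (d + 1) + 1 - (i + d + 1) = 1 by omega]
    rw [h2]
    have := h1.append (ChainFromTo.single H (f (i + d + 1))) (by
      simpa using hf (i + d) (by omega) (by omega))
    simpa [show i + (d + 1) = i + d + 1 by omega] using this

theorem nodup_seg {f : ℕ → V} {i j : ℕ} (hf : ∀ a, i ≤ a → a < j → ∀ b, i ≤ b → b < j →
    f a = f b → a = b) : (seg f i j).Nodup := by
  apply List.Nodup.map_on _ List.nodup_range'
  simp only [List.mem_range'_1]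
  intro a ha b hb hab
  exact hf a (by omega) (by omega) b (by omega) (by omega) hab

end Seg

end Lists

section Dense

set_option linter.unusedSectionVars false

variable {V : Type*} [Fintype V] [DecidableEq V]

open Classical in
/-- The neighbours of `u`, as a finset. -/
noncomputable def nb (H : SimpleGraph V) (u : V) : Finset V :=
  Finset.univ.filter fun w => H.Adj u w

@[simp]
theorem mem_nb {H : SimpleGraph V} {u w : V} : w ∈ nb H u ↔ H.Adj u w := by
  simp [nb]

/-- `H` has `2 * n` vertices and any two vertices have together at least `n - 1` further
neighbours. -/
def PairDense (H : SimpleGraph V) (n : ℕ) : Prop :=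
  Fintype.card V = 2 * n ∧
    ∀ u w, u ≠ w → n + 1 ≤ (insert u (insert w (nb H u ∪ nb H w))).card

theorem pairDense_compl {G : SimpleGraph V} {n : ℕ} (hcard : Fintype.card V = 2 * n)
    (hG : ¬ Contains G (completeBipartiteGraph (Fin 2) (Fin n))) : PairDense Gᶜ n := by
  refine ⟨hcard, fun u w huw => ?_⟩
  by_contra! hlt
  set S := insert u (insert w (nb Gᶜ u ∪ nb Gᶜ w)) with hS
  have h1 : n ≤ Sᶜ.card := by
    rw [Finset.card_compl]; omega
  obtain ⟨T, hT, hTn⟩ := Finset.exists_subset_card_eq h1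
  have hadj : ∀ z ∈ T, G.Adj u z ∧ G.Adj w z ∧ z ≠ u ∧ z ≠ w := by
    intro z hz
    have := hT hz
    simp only [hS, Finset.mem_compl, Finset.mem_insert, Finset.mem_union, mem_nb,
      compl_adj, not_or, not_and, not_not] at this
    obtain ⟨h1, h2, h3, h4⟩ := this
    exact ⟨h3 (Ne.symm h1), h4 (Ne.symm h2), h1, h2⟩
  let g : Fin n → V := fun i => (T.equivFinOfCardEq hTn).symm i
  have hg : ∀ i, g i ∈ T := fun i => ((T.equivFinOfCardEq hTn).symm i).2
  have hginj : Function.Injective g :=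
    Subtype.val_injective.comp (T.equivFinOfCardEq hTn).symm.injective
  let p : Fin 2 → V := ![u, w]
  have hpadj : ∀ i j, G.Adj (p i) (g j) := by
    intro i j
    have := hadj _ (hg j)
    fin_cases i
    · exact this.1
    · exact this.2.1
  apply hG
  refine ⟨⟨Sum.elim p g, ?_⟩, ?_⟩
  · rintro (i | i) (j | j) hij
    · simp at hij
    · exact hpadj i j
    · exact (hpadj j i).symm
    · simp at hij
  · rw [RelHom.coeFn_mk]
    refine Function.Injective.sumElim ?_ hginj fun i j => (hpadj i j).ne
    intro i j hij
    fin_cases i <;> fin_cases j <;> simp_all [p]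

namespace PairDense

variable {H : SimpleGraph V} {n : ℕ}

theorem mono {K : SimpleGraph V} (hHK : H ≤ K) (h : PairDense H n) : PairDense K n := by
  refine ⟨h.1, fun u w huw => (h.2 u w huw).trans (Finset.card_le_card ?_)⟩
  intro z
  simp only [Finset.mem_insert, Finset.mem_union, mem_nb]
  rintro (h | h | h | h)
  · exact Or.inl h
  · exact Or.inr (Or.inl h)
  · exact Or.inr (Or.inr (Or.inl (hHK h)))
  · exact Or.inr (Or.inr (Or.inr (hHK h)))

theorem card_union (h : PairDense H n) {u w : V} (huw : u ≠ w) :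
    n ≤ (nb H u ∪ nb H w).card + 1 := by
  have h1 := h.2 u w huw
  have h2 := Finset.card_insert_le u (insert w (nb H u ∪ nb H w))
  have h3 := Finset.card_insert_le w (nb H u ∪ nb H w)
  omega

theorem card_add (h : PairDense H n) {u w : V} (huw : u ≠ w) :
    n ≤ (nb H u).card + (nb H w).card + 1 := by
  have := h.card_union huw
  have := Finset.card_union_le (nb H u) (nb H w)
  omega

theorem exists_exceptional (h : PairDense H n) (hn : 0 < n) :
    ∃ v, ∀ u, u ≠ v → n ≤ 2 * (nb H u).card + 1 := by
  have : Nonempty V := Fintype.card_pos_iff.1 (by rw [h.1]; omega)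
  obtain ⟨v, -, hv⟩ := Finset.exists_min_image Finset.univ (fun u => (nb H u).card)
    Finset.univ_nonempty
  refine ⟨v, fun u hu => ?_⟩
  have := h.card_add hu
  have := hv u (Finset.mem_univ _)
  omega

end PairDense

theorem exists_injective_choice : ∀ (k : ℕ) (A : Fin k → Finset V) (F : Finset V),
    (∀ i, F.card + k ≤ (A i).card) →
      ∃ g : Fin k → V, Function.Injective g ∧ ∀ i, g i ∈ A i ∧ g i ∉ F
  | 0, _, _, _ => ⟨Fin.elim0, fun i => i.elim0, fun i => i.elim0⟩
  | k + 1, A, F, hA => by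
    have h0 : F.card < (A 0).card := by have := hA 0; omega
    obtain ⟨z, hz, hzF⟩ := Finset.exists_mem_notMem_of_card_lt_card h0
    obtain ⟨g, hg, hgA⟩ := exists_injective_choice k (fun i => A i.succ) (insert z F) (by
      intro i
      have := hA i.succ
      have := Finset.card_insert_le z F
      omega)
    refine ⟨Fin.cons z g, ?_, ?_⟩
    · rw [Fin.cons_injective_iff]
      refine ⟨?_, hg⟩
      rintro ⟨i, hi⟩
      exact (hgA i).2 (hi ▸ Finset.mem_insert_self _ _)
    · intro i
      refine Fin.cases ⟨hz, hzF⟩ (fun j => ?_) i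
      simp only [Fin.cons_succ]
      exact ⟨(hgA j).1, fun h => (hgA j).2 (Finset.mem_insert_of_mem h)⟩

open Classical in
theorem exists_clique_or_coclique (r : V → V → Prop) (hr : ∀ x y, r x y → r y x) :
    ∀ (N s t : ℕ), s + t = N → ∀ S : Finset V, (s + t).choose s ≤ S.card →
      (∃ T ⊆ S, T.card = s + 1 ∧ ∀ x ∈ T, ∀ y ∈ T, x ≠ y → ¬ r x y) ∨
      (∃ T ⊆ S, T.card = t + 1 ∧ ∀ x ∈ T, ∀ y ∈ T, x ≠ y → r x y) := by
  intro N
  induction N with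
  | zero =>
    intro s t hst S hS
    obtain ⟨rfl, rfl⟩ : s = 0 ∧ t = 0 := by omega
    obtain ⟨T, hT, hTc⟩ := Finset.exists_subset_card_eq (s := S) (n := 1) (by simpa using hS)
    left
    obtain ⟨a, rfl⟩ := Finset.card_eq_one.1 hTc
    exact ⟨{a}, hT, by simp, by simp⟩
  | succ N ih =>
    intro s t hst S hS
    have hpos : 0 < S.card := lt_of_lt_of_le (Nat.choose_pos (by omega)) hS
    obtain ⟨a, ha⟩ := Finset.card_pos.1 hpos
    rcases s with _ | s
    · exact Or.inl ⟨{a}, by simpa using ha, by simp, by simp⟩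
    rcases t with _ | t
    · exact Or.inr ⟨{a}, by simpa using ha, by simp, by simp⟩
    set P := (S.erase a).filter fun x => r a x
    set Q := (S.erase a).filter fun x => ¬ r a x
    have hPQ : P.card + Q.card + 1 = S.card := by
      rw [Finset.card_filter_add_card_filter_not, Finset.card_erase_add_one ha]
    have hch : (s + 1 + (t + 1)).choose (s + 1)
        = (s + (t + 1)).choose s + (s + 1 + t).choose (s + 1) := by
      rw [show s + 1 + (t + 1) = (s + t + 1) + 1 by ring, Nat.choose_succ_succ,
        show s + (t + 1) = s + t + 1 by ring, show s + 1 + t = s + t + 1 by ring]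
    have hsub : ∀ x ∈ S.erase a, x ∈ S := fun x hx => Finset.mem_of_mem_erase hx
    by_cases hQ : (s + (t + 1)).choose s ≤ Q.card
    · rcases ih s (t + 1) (by omega) Q hQ with ⟨T, hT, hc, hp⟩ | ⟨T, hT, hc, hp⟩
      · left
        have haT : a ∉ T := fun h => by simpa [Q] using hT h
        refine ⟨insert a T, ?_, by rw [Finset.card_insert_of_notMem haT, hc], ?_⟩
        · exact Finset.insert_subset ha fun x hx => hsub x (Finset.mem_filter.1 (hT hx)).1
        · have key : ∀ x ∈ T, ¬ r a x := fun x hx => (Finset.mem_filter.1 (hT hx)).2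
          intro x hx y hy hxy
          rcases Finset.mem_insert.1 hx with rfl | hx' <;> rcases Finset.mem_insert.1 hy with rfl | hy'
          · exact absurd rfl hxy
          · exact key y hy'
          · exact fun h => key x hx' (hr _ _ h)
          · exact hp x hx' y hy' hxy
      · exact Or.inr ⟨T, fun x hx => hsub x (Finset.mem_filter.1 (hT hx)).1, hc, hp⟩
    · have hP : (s + 1 + t).choose (s + 1) ≤ P.card := by omega
      rcases ih (s + 1) t (by omega) P hP with ⟨T, hT, hc, hp⟩ | ⟨T, hT, hc, hp⟩
      · exact Or.inl ⟨T, fun x hx => hsub x (Finset.mem_filter.1 (hT hx)).1, hc, hp⟩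
      · right
        have haT : a ∉ T := fun h => by simpa [P] using hT h
        refine ⟨insert a T, ?_, by rw [Finset.card_insert_of_notMem haT, hc], ?_⟩
        · exact Finset.insert_subset ha fun x hx => hsub x (Finset.mem_filter.1 (hT hx)).1
        · have key : ∀ x ∈ T, r a x := fun x hx => (Finset.mem_filter.1 (hT hx)).2
          intro x hx y hy hxy
          rcases Finset.mem_insert.1 hx with rfl | hx' <;> rcases Finset.mem_insert.1 hy with rfl | hy'
          · exact absurd rfl hxy
          · exact key y hy'
          · exact hr _ _ (key x hx')
          · exact hp x hx' y hy' hxy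

end Dense

section Gadget

set_option linter.unusedSectionVars false

variable {V : Type*} [Fintype V] [DecidableEq V] {H : SimpleGraph V} {n : ℕ}

theorem card_union_inter_union_le (A B C D : Finset V) :
    ((A ∪ B) ∩ (C ∪ D)).card ≤
      (A ∩ C).card + (A ∩ D).card + (B ∩ C).card + (B ∩ D).card := by
  have h1 : (A ∪ B) ∩ (C ∪ D) = ((A ∩ C) ∪ (A ∩ D)) ∪ ((B ∩ C) ∪ (B ∩ D)) := by
    ext z; simp only [Finset.mem_inter, Finset.mem_union]; tauto
  rw [h1]
  have := Finset.card_union_le ((A ∩ C) ∪ (A ∩ D)) ((B ∩ C) ∪ (B ∩ D))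
  have := Finset.card_union_le (A ∩ C) (A ∩ D)
  have := Finset.card_union_le (B ∩ C) (B ∩ D)
  omega

theorem PairDense.exists_codegree (h : PairDense H n) (hn : 4511 ≤ n) (T : Finset V)
    (hT : T.card = 6) :
    ∃ x ∈ T, ∃ y ∈ T, x ≠ y ∧ 375 ≤ (nb H x ∩ nb H y).card := by
  by_contra! hc
  let x : Fin 6 → V := fun i => (T.equivFinOfCardEq hT).symm i
  have hx : ∀ i, x i ∈ T := fun i => ((T.equivFinOfCardEq hT).symm i).2
  have hinj : Function.Injective x :=
    Subtype.val_injective.comp (T.equivFinOfCardEq hT).symm.injective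
  have hcc : ∀ i j, i ≠ j → (nb H (x i) ∩ nb H (x j)).card < 375 :=
    fun i j hij => hc _ (hx i) _ (hx j) (hinj.ne hij)
  have hu : ∀ i j, i ≠ j → n ≤ (nb H (x i) ∪ nb H (x j)).card + 1 :=
    fun i j hij => h.card_union (hinj.ne hij)
  have key : ∀ i j k l : Fin 6, i ≠ k → i ≠ l → j ≠ k → j ≠ l →
      ((nb H (x i) ∪ nb H (x j)) ∩ (nb H (x k) ∪ nb H (x l))).card ≤ 4 * 374 := by
    intro i j k l h1 h2 h3 h4
    have := card_union_inter_union_le (nb H (x i)) (nb H (x j)) (nb H (x k)) (nb H (x l))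
    have := hcc i k h1
    have := hcc i l h2
    have := hcc j k h3
    have := hcc j l h4
    omega
  have k1 := key 0 1 2 3 (by decide) (by decide) (by decide) (by decide)
  have k2 := key 0 1 4 5 (by decide) (by decide) (by decide) (by decide)
  have k3 := key 2 3 4 5 (by decide) (by decide) (by decide) (by decide)
  have u1 := hu 0 1 (by decide)
  have u2 := hu 2 3 (by decide)
  have u3 := hu 4 5 (by decide)
  generalize nb H (x 0) ∪ nb H (x 1) = A at *
  generalize nb H (x 2) ∪ nb H (x 3) = B at *
  generalize nb H (x 4) ∪ nb H (x 5) = C at *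
  have c1 := Finset.card_union_add_card_inter A B
  have c2 := Finset.card_union_add_card_inter (A ∪ B) C
  have c3 : ((A ∪ B) ∩ C).card ≤ (A ∩ C).card + (B ∩ C).card := by
    rw [Finset.union_inter_distrib_right]; exact Finset.card_union_le _ _
  have c4 := Finset.card_le_univ (A ∪ B ∪ C)
  rw [h.1] at c4
  omega

/-- Vertices `g 0, …, g 14` form a path all of whose odd-length shortcuts through
`g 15, …, g 20` are available. -/
structure IsGadget (H : SimpleGraph V) (g : ℕ → V) : Prop where
  inj : ∀ i < 21, ∀ j < 21, g i = g j → i = j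
  adj : ∀ i < 14, H.Adj (g i) (g (i + 1))
  adj_left : ∀ j < 6, H.Adj (g 0) (g (15 + j))
  adj_right : ∀ j < 6, H.Adj (g (15 + j)) (g (4 + 2 * j))

theorem PairDense.exists_gadget (h : PairDense H n) (hn : 4511 ≤ n) (v : V) :
    ∃ g : ℕ → V, IsGadget H g ∧ ∀ i < 21, g i ≠ v := by
  obtain ⟨T, hTv, hTc, hT⟩ : ∃ T ⊆ Finset.univ.erase v, T.card = 8 ∧
      ∀ x ∈ T, ∀ y ∈ T, x ≠ y → 375 ≤ (nb H x ∩ nb H y).card := by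
    have hS : Nat.choose (5 + 7) 5 ≤ (Finset.univ.erase v).card := by
      rw [Finset.card_erase_of_mem (Finset.mem_univ v), Finset.card_univ, h.1,
        show Nat.choose (5 + 7) 5 = 792 from rfl]
      omega
    rcases exists_clique_or_coclique (fun x y => 375 ≤ (nb H x ∩ nb H y).card)
      (fun x y hxy => by rwa [Finset.inter_comm]) 12 5 7 rfl _ hS with ⟨T, -, hc, hp⟩ | h'
    · obtain ⟨x, hx, y, hy, hxy, hle⟩ := h.exists_codegree hn T hc
      exact absurd hle (hp x hx y hy hxy)
    · exact h'
  let x : Fin 8 → V := fun i => (T.equivFinOfCardEq hTc).symm i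
  have hx : ∀ i, x i ∈ T := fun i => ((T.equivFinOfCardEq hTc).symm i).2
  have hinj : Function.Injective x :=
    Subtype.val_injective.comp (T.equivFinOfCardEq hTc).symm.injective
  let a : Fin 13 → Fin 8 := fun i => if i.val < 7 then Fin.ofNat 8 i.val else 0
  let b : Fin 13 → Fin 8 :=
    fun i => if i.val < 7 then Fin.ofNat 8 (i.val + 1) else Fin.ofNat 8 (i.val - 5)
  have hab : ∀ i, a i ≠ b i := by decide
  obtain ⟨c, hcinj, hc⟩ := exists_injective_choice 13
    (fun i => nb H (x (a i)) ∩ nb H (x (b i))) (insert v T) (by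
      intro i
      have h1 := hT _ (hx (a i)) _ (hx (b i)) (hinj.ne (hab i))
      have h2 := Finset.card_insert_le v T
      omega)
  let idx : ℕ → Fin 8 ⊕ Fin 13 := fun i =>
    if i < 15 then if i % 2 = 0 then Sum.inl (Fin.ofNat 8 (i / 2)) else Sum.inr (Fin.ofNat 13 (i / 2))
    else Sum.inr (Fin.ofNat 13 (i - 8))
  have hidx : ∀ i < 21, ∀ j < 21, idx i = idx j → i = j := by decide
  have hg : Function.Injective (Sum.elim x c) := by
    refine Function.Injective.sumElim hinj hcinj fun i j hij => (hc j).2 ?_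
    rw [← hij]; exact Finset.mem_insert_of_mem (hx i)
  have hl : ∀ i, H.Adj (x (a i)) (c i) := fun i => mem_nb.1 (Finset.mem_inter.1 (hc i).1).1
  have hr : ∀ i, H.Adj (x (b i)) (c i) := fun i => mem_nb.1 (Finset.mem_inter.1 (hc i).1).2
  refine ⟨fun i => Sum.elim x c (idx i), ⟨fun i hi j hj hij => hidx i hi j hj (hg hij), ?_, ?_, ?_⟩,
    ?_⟩
  · intro i hi
    interval_cases i
    · exact hl 0
    · exact (hr 0).symm
    · exact hl 1
    · exact (hr 1).symm
    · exact hl 2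
    · exact (hr 2).symm
    · exact hl 3
    · exact (hr 3).symm
    · exact hl 4
    · exact (hr 4).symm
    · exact hl 5
    · exact (hr 5).symm
    · exact hl 6
    · exact (hr 6).symm
  · intro j hj
    interval_cases j
    · exact hl 7
    · exact hl 8
    · exact hl 9
    · exact hl 10
    · exact hl 11
    · exact hl 12
  · intro j hj
    interval_cases j
    · exact (hr 7).symm
    · exact (hr 8).symm
    · exact (hr 9).symm
    · exact (hr 10).symm
    · exact (hr 11).symm
    · exact (hr 12).symm
  · intro i _
    rcases hi : idx i with k | k
    · simp only [hi, Sum.elim_inl]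
      exact fun h => by simpa [h] using hTv (hx k)
    · simp only [hi, Sum.elim_inr]
      exact fun h => (hc k).2 (h ▸ Finset.mem_insert_self _ _)

/-- The gadget's path of length `15 - 2 * r`. -/
def gadgetPath (g : ℕ → V) : ℕ → List V
  | 0 => seg g 0 15
  | r + 1 => g 0 :: g (15 + r) :: seg g (4 + 2 * r) 15

variable {g : ℕ → V}

theorem IsGadget.length_gadgetPath {r : ℕ} (hr : r ≤ 6) :
    (gadgetPath g r).length = 15 - 2 * r := by
  cases r with
  | zero => simp [gadgetPath]
  | succ r => simp [gadgetPath]; omega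

theorem IsGadget.chain (hg : IsGadget H g) {r : ℕ} (hr : r ≤ 6) :
    ChainFromTo H (g 0) (g 14) (gadgetPath g r) := by
  cases r with
  | zero => exact chainFromTo_seg (by omega) fun k _ hk => hg.adj k (by omega)
  | succ r =>
    have h1 := chainFromTo_seg (H := H) (f := g) (i := 4 + 2 * r) (j := 15) (by omega)
      fun k _ hk => hg.adj k (by omega)
    exact (h1.cons (hg.adj_right r (by omega))).cons (hg.adj_left r (by omega))

theorem IsGadget.mem_gadgetPath {r : ℕ} (hr : r ≤ 6) {x : V} (hx : x ∈ gadgetPath g r) :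
    x ∈ seg g 0 15 ∨ x ∈ seg g 15 21 := by
  cases r with
  | zero => exact Or.inl hx
  | succ r =>
    simp only [gadgetPath, List.mem_cons, mem_seg] at hx
    simp only [mem_seg]
    rcases hx with rfl | rfl | ⟨k, h1, h2, rfl⟩
    · exact Or.inl ⟨0, by omega, by omega, rfl⟩
    · exact Or.inr ⟨_, by omega, by omega, rfl⟩
    · exact Or.inl ⟨k, by omega, by omega, rfl⟩

theorem IsGadget.nodup (hg : IsGadget H g) {r : ℕ} (hr : r ≤ 6) : (gadgetPath g r).Nodup := by
  cases r with
  | zero => exact nodup_seg fun a _ ha b _ hb => hg.inj a (by omega) b (by omega)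
  | succ r =>
    simp only [gadgetPath, List.nodup_cons, List.mem_cons, mem_seg, not_or, not_exists, not_and]
    refine ⟨⟨fun h => ?_, fun k h1 h2 h => ?_⟩, fun k h1 h2 h => ?_, nodup_seg
      fun a _ ha b _ hb => hg.inj a (by omega) b (by omega)⟩
    · have := hg.inj _ (by omega) _ (by omega) h; omega
    · have := hg.inj _ (by omega) _ (by omega) h; omega
    · have := hg.inj _ (by omega) _ (by omega) h; omega

/-- Replacing the path of a gadget inside a closed chain by a shorter one. -/
theorem IsGadget.exists_isCyc (hg : IsGadget H g) {c : List V} (hc : IsCyc H c)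
    (hB : seg g 0 15 <:+: c ∨ seg g 0 15 <:+: c.reverse) (hE : ∀ x ∈ c, x ∉ seg g 15 21)
    {r : ℕ} (hr : r ≤ 6) : ∃ c', IsCyc H c' ∧ c'.length + 2 * r = c.length := by
  have main : ∀ c : List V, IsCyc H c → seg g 0 15 <:+: c → (∀ x ∈ c, x ∉ seg g 15 21) →
      ∃ c', IsCyc H c' ∧ c'.length + 2 * r = c.length := by
    rintro c hc ⟨s, t, rfl⟩ hE
    rw [List.append_assoc] at hc
    have hc2 := hc.rotate
    rw [List.append_assoc] at hc2
    refine ⟨gadgetPath g r ++ (t ++ s), ?_, ?_⟩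
    · obtain ⟨hn, a, b, hch, hab⟩ := hc2
      have h0 := hg.chain (r := 0) (by omega)
      have h1 := hg.chain hr
      have hn' := List.nodup_append.1 hn
      refine ⟨List.nodup_append.2 ⟨hg.nodup hr, hn'.2.1, ?_⟩, ?_⟩
      · rintro x hx y hy rfl
        rcases IsGadget.mem_gadgetPath hr hx with h | h
        · exact hn'.2.2 x h x hy rfl
        · refine hE x ?_ h
          simp only [List.mem_append] at hy ⊢
          tauto
      · rcases eq_or_ne (t ++ s) [] with h | h
        · rw [h, List.append_nil] at hch ⊢
          have e1 : a = g 0 := Option.some.inj (hch.2.1.symm.trans h0.2.1)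
          have e2 : b = g 14 := Option.some.inj (hch.2.2.symm.trans h0.2.2)
          exact ⟨_, _, h1, e1 ▸ e2 ▸ hab⟩
        · obtain ⟨k1, k2, k3⟩ := List.isChain_append.1 hch.1
          have h2 := ChainFromTo.of_isChain k2 h
          have e1 : a = g 0 := by
            have := hch.2.1
            rw [List.head?_append, show (seg g 0 15).head? = _ from h0.2.1] at this
            simpa using this.symm
          have e2 : b = (t ++ s).getLast h := by
            have := hch.2.2
            rw [List.getLast?_append, h2.2.2] at this
            simpa using this.symm
          refine ⟨_, _, h1.append h2 ?_, e1 ▸ e2 ▸ hab⟩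
          exact k3 _ (by rw [show (seg g 0 15).getLast? = _ from h0.2.2]; simp) _
            (by rw [h2.2.1]; simp)
    · simp [IsGadget.length_gadgetPath hr]; omega
  rcases hB with hB | hB
  · exact main c hc hB hE
  · obtain ⟨c', h1, h2⟩ := main c.reverse hc.reverse hB (by simpa using hE)
    exact ⟨c', h1, by simpa using h2⟩

end Gadget

section Track

set_option linter.unusedSectionVars false

variable {V : Type*} {H : SimpleGraph V}

/-- `f 0, …, f (ℓ - 1)` is a path of `H` avoiding `R`. -/
structure IsTrack (H : SimpleGraph V) (R : Finset V) (f : ℕ → V) (ℓ : ℕ) : Prop where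
  inj : ∀ i < ℓ, ∀ j < ℓ, f i = f j → i = j
  notMem : ∀ i < ℓ, f i ∉ R
  adj : ∀ i, i + 1 < ℓ → H.Adj (f i) (f (i + 1))

/-- `l` contains `B` as a segment, in one of the two directions. -/
def HasSegment (B l : List V) : Prop := B <:+: l ∨ B <:+: l.reverse

namespace HasSegment

variable {B l l' : List V}

theorem reverse (h : HasSegment B l) : HasSegment B l.reverse := by
  rcases h with h | h
  · exact Or.inr (by simpa using h)
  · exact Or.inl h

theorem append_right (h : HasSegment B l) (l' : List V) : HasSegment B (l ++ l') := by
  rcases h with h | h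
  · exact Or.inl (h.trans (List.prefix_append _ _).isInfix)
  · exact Or.inr (by rw [List.reverse_append]; exact h.trans (List.suffix_append _ _).isInfix)

theorem append_left (h : HasSegment B l) (l' : List V) : HasSegment B (l' ++ l) := by
  rcases h with h | h
  · exact Or.inl (h.trans (List.suffix_append _ _).isInfix)
  · exact Or.inr (by rw [List.reverse_append]; exact h.trans (List.prefix_append _ _).isInfix)

theorem cons (h : HasSegment B l) (z : V) : HasSegment B (z :: l) := h.append_left [z]

theorem seg {f : ℕ → V} {i j a b : ℕ} (hia : i ≤ a) (hab : a ≤ b) (hbj : b ≤ j) :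
    HasSegment (seg f a b) (seg f i j) :=
  Or.inl ⟨_root_.seg f i a, _root_.seg f b j, by
    rw [seg_append f hia hab, seg_append f (by omega) hbj]⟩

end HasSegment

/-- A path `l` from `a` to `b` whose vertices have the form `f k` with `k < ℓ` and `P k`. -/
structure IsRun (H : SimpleGraph V) (f : ℕ → V) (ℓ : ℕ) (P : ℕ → Prop) (a b : V) (l : List V) :
    Prop where
  chain : ChainFromTo H a b l
  nodup : l.Nodup
  mem : ∀ x ∈ l, ∃ k < ℓ, P k ∧ f k = x

namespace IsRun

variable {R : Finset V} {f : ℕ → V} {ℓ : ℕ} {P Q : ℕ → Prop} {a b c d z : V} {l l' : List V}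

theorem seg (hf : IsTrack H R f ℓ) {i j : ℕ} (hij : i < j) (hj : j ≤ ℓ) :
    IsRun H f ℓ (fun k => i ≤ k ∧ k < j) (f i) (f (j - 1)) (seg f i j) where
  chain := chainFromTo_seg hij fun k _ hk => hf.adj k (by omega)
  nodup := nodup_seg fun a _ ha b _ hb => hf.inj a (by omega) b (by omega)
  mem x hx := by
    obtain ⟨k, h1, h2, rfl⟩ := mem_seg.1 hx
    exact ⟨k, by omega, ⟨h1, h2⟩, rfl⟩

theorem rev (h : IsRun H f ℓ P a b l) : IsRun H f ℓ P b a l.reverse where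
  chain := h.chain.rev
  nodup := List.nodup_reverse.2 h.nodup
  mem x hx := h.mem x (by simpa using hx)

theorem append (hf : IsTrack H R f ℓ) (h : IsRun H f ℓ P a b l) (h' : IsRun H f ℓ Q c d l')
    (hbc : H.Adj b c) (hPQ : ∀ k, P k → Q k → False) :
    IsRun H f ℓ (fun k => P k ∨ Q k) a d (l ++ l') where
  chain := h.chain.append h'.chain hbc
  nodup := by
    refine List.nodup_append.2 ⟨h.nodup, h'.nodup, ?_⟩
    rintro x hx y hy rfl
    obtain ⟨k, hk, hP, rfl⟩ := h.mem x hx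
    obtain ⟨k', hk', hQ, he⟩ := h'.mem _ hy
    obtain rfl := hf.inj _ hk' _ hk he
    exact hPQ _ hP hQ
  mem x hx := by
    rcases List.mem_append.1 hx with hx | hx
    · obtain ⟨k, h1, h2, h3⟩ := h.mem x hx
      exact ⟨k, h1, Or.inl h2, h3⟩
    · obtain ⟨k, h1, h2, h3⟩ := h'.mem x hx
      exact ⟨k, h1, Or.inr h2, h3⟩

end IsRun

/-- An even cycle avoiding `R`, containing `B` as a segment, of length almost `ℓ`. -/
def HasClosing (H : SimpleGraph V) (R : Finset V) (B : List V) (ℓ : ℕ) : Prop :=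
  ∃ c, IsCyc H c ∧ (∀ x ∈ c, x ∉ R) ∧ HasSegment B c ∧ Even c.length ∧ ℓ ≤ c.length + 8 ∧
    c.length ≤ ℓ + 2

namespace IsRun

variable {R : Finset V} {f : ℕ → V} {ℓ L : ℕ} {P Q : ℕ → Prop} {a b c d z z' : V} {l l' B : List V}

theorem notMem_of_forall_ne (h : IsRun H f ℓ P a b l) (hz : ∀ k < ℓ, P k → f k ≠ z) : z ∉ l :=
  fun hzl => by
    obtain ⟨k, h1, h2, h3⟩ := h.mem z hzl
    exact hz k h1 h2 h3

theorem closing (hf : IsTrack H R f ℓ) (h : IsRun H f ℓ P a b l) (hba : H.Adj b a)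
    (hB : HasSegment B l) (he : Even l.length) (h1 : ℓ ≤ l.length + 8) (h2 : l.length ≤ ℓ + 2) :
    HasClosing H R B ℓ := by
  refine ⟨l, ⟨h.nodup, a, b, h.chain, hba⟩, fun x hx => ?_, hB, he, h1, h2⟩
  obtain ⟨k, hk, -, rfl⟩ := h.mem x hx
  exact hf.notMem k hk

theorem closing_cons (hf : IsTrack H R f ℓ) (h : IsRun H f ℓ P a b l) (hza : H.Adj z a)
    (hbz : H.Adj b z) (hzR : z ∉ R) (hz : ∀ k < ℓ, P k → f k ≠ z)
    (hB : HasSegment B l) (he : Even (l.length + 1)) (h1 : ℓ ≤ l.length + 9)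
    (h2 : l.length ≤ ℓ + 1) : HasClosing H R B ℓ := by
  refine ⟨z :: l, ⟨List.nodup_cons.2 ⟨h.notMem_of_forall_ne hz, h.nodup⟩, z, b,
    h.chain.cons hza, hbz⟩, fun x hx => ?_, hB.cons z, by simpa using he, by simp; omega,
    by simp; omega⟩
  rcases List.mem_cons.1 hx with rfl | hx
  · exact hzR
  · obtain ⟨k, hk, -, rfl⟩ := h.mem x hx
    exact hf.notMem k hk

theorem closing_cons_cons (hf : IsTrack H R f ℓ) (h : IsRun H f ℓ P a b l) (hza : H.Adj z a)
    (hzz : H.Adj z' z) (hbz : H.Adj b z') (hzR : z ∉ R) (hz : ∀ k < ℓ, P k → f k ≠ z)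
    (hzR' : z' ∉ R) (hz' : ∀ k < ℓ, P k → f k ≠ z')
    (hB : HasSegment B l) (he : Even l.length) (h1 : ℓ ≤ l.length + 10)
    (h2 : l.length ≤ ℓ) : HasClosing H R B ℓ := by
  refine ⟨z' :: z :: l, ⟨List.nodup_cons.2 ⟨?_,
    List.nodup_cons.2 ⟨h.notMem_of_forall_ne hz, h.nodup⟩⟩, z', b,
    (h.chain.cons hza).cons hzz, hbz⟩, fun x hx => ?_, (hB.cons z).cons z', ?_, by simp; omega,
    by simp; omega⟩
  · rw [List.mem_cons, not_or]
    exact ⟨hzz.ne, h.notMem_of_forall_ne hz'⟩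
  · rcases List.mem_cons.1 hx with rfl | hx
    · exact hzR'
    rcases List.mem_cons.1 hx with rfl | hx
    · exact hzR
    · obtain ⟨k, hk, -, rfl⟩ := h.mem x hx
      exact hf.notMem k hk
  · simp only [List.length_cons]
    rw [Nat.even_iff] at he ⊢; omega

end IsRun

namespace IsTrack

variable {R : Finset V} {f : ℕ → V} {ℓ β s t : ℕ} {z z' : V}

/-- `z` lies outside the path and outside `R`. -/
def Outside (R : Finset V) (f : ℕ → V) (ℓ : ℕ) (z : V) : Prop := z ∉ R ∧ ∀ k < ℓ, f k ≠ z

section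

variable (hf : IsTrack H R f ℓ) (hs : s ≤ 3) (ht : t ≤ ℓ) (ht' : ℓ ≤ t + 3) (hβ : 12 ≤ β)
  (hβ' : β + 27 ≤ ℓ) (hℓ : Even ℓ)

include hf hs ht ht' hβ hβ' hℓ

theorem closing_outside (hpar : (t - s) % 2 = 1) (hz : Outside R f ℓ z) (h1 : H.Adj z (f s))
    (h2 : H.Adj (f (t - 1)) z) : HasClosing H R (seg f β (β + 15)) ℓ :=
  (IsRun.seg hf (i := s) (j := t) (by omega) ht).closing_cons hf h1 h2 hz.1
    (fun k hk _ => hz.2 k hk) (HasSegment.seg (by omega) (by omega) (by omega))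
    (by rw [length_seg, Nat.even_iff]; omega) (by rw [length_seg]; omega)
    (by rw [length_seg]; omega)

theorem closing_two_outside (hpar : (t - s) % 2 = 0) (hz : Outside R f ℓ z)
    (hz' : Outside R f ℓ z') (h1 : H.Adj z (f s)) (h2 : H.Adj (f (t - 1)) z') (h3 : H.Adj z' z) :
    HasClosing H R (seg f β (β + 15)) ℓ :=
  (IsRun.seg hf (i := s) (j := t) (by omega) ht).closing_cons_cons hf h1 h3 h2 hz.1
    (fun k hk _ => hz.2 k hk) hz'.1
    (fun k hk _ => hz'.2 k hk) (HasSegment.seg (by omega) (by omega) (by omega))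
    (by rw [length_seg, Nat.even_iff]; omega) (by rw [length_seg]; omega)
    (by rw [length_seg]; omega)

theorem closing_crossing {k σ : ℕ} (hpar : (t - s) % 2 = 1) (hσ : σ = 2 ∨ σ = 4) (hk : 8 ≤ k)
    (hk' : k + 4 ≤ ℓ) (hkβ : k ≤ β ∨ β + 18 ≤ k) (h1 : H.Adj (f k) (f s))
    (h2 : H.Adj (f (k - σ)) (f (t - 1))) : HasClosing H R (seg f β (β + 15)) ℓ := by
  have hℓ' := Nat.even_iff.1 hℓ
  refine ((IsRun.seg hf (i := s) (j := k - σ + 1) (by omega) (by omega)).append hf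
    (IsRun.seg hf (i := k) (j := t) (by omega) ht).rev (by simpa using h2)
    (fun j _ _ => by omega)).closing hf h1 ?_ ?_ ?_ ?_
  · rcases hkβ with h | h
    · exact (HasSegment.seg (by omega) (by omega) (by omega)).reverse.append_left _
    · exact (HasSegment.seg (by omega) (by omega) (by omega)).append_right _
  all_goals simp only [List.length_append, List.length_reverse, length_seg, Nat.even_iff]; omega

theorem closing_outside_crossing {k : ℕ} (hpar : (t - s) % 2 = 0) (hk : 8 ≤ k)
    (hk' : k + 4 ≤ ℓ) (hkβ : k ≤ β ∨ β + 18 ≤ k) (hz : Outside R f ℓ z) (h1 : H.Adj z (f s))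
    (h2 : H.Adj (f (k - 2)) (f (t - 1))) (h3 : H.Adj (f k) z) :
    HasClosing H R (seg f β (β + 15)) ℓ := by
  refine ((IsRun.seg hf (i := s) (j := k - 1) (by omega) (by omega)).append hf
    (IsRun.seg hf (i := k) (j := t) (by omega) ht).rev
    (by simpa [Nat.sub_sub] using h2)
    (fun j _ _ => by omega)).closing_cons hf h1 h3 hz.1 (fun k hk _ => hz.2 k hk) ?_ ?_ ?_ ?_
  · rcases hkβ with h | h
    · exact (HasSegment.seg (by omega) (by omega) (by omega)).reverse.append_left _
    · exact (HasSegment.seg (by omega) (by omega) (by omega)).append_right _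
  all_goals simp only [List.length_append, List.length_reverse, length_seg, Nat.even_iff]; omega

theorem closing_rotated {i p : ℕ} (hpar : (t - s) % 2 = 0) (hp : p = i + 2 ∨ p = i + 4)
    (hi : 8 ≤ i) (hi' : i + 8 ≤ ℓ) (hiβ : i + 4 ≤ β ∨ β + 18 ≤ i) (h1 : H.Adj (f s) (f p))
    (hzR : z ∉ R) (hz : ∀ k < ℓ, k ≤ i ∨ p ≤ k → f k ≠ z) (h2 : H.Adj z (f i))
    (h3 : H.Adj (f (t - 1)) z) : HasClosing H R (seg f β (β + 15)) ℓ := by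
  refine ((IsRun.seg hf (i := s) (j := i + 1) (by omega) (by omega)).rev.append hf
    (IsRun.seg hf (i := p) (j := t) (by omega) ht) h1
    (fun j _ _ => by omega)).closing_cons hf (by simpa using h2) h3 hzR
    (fun k hk hk' => hz k hk (by omega)) ?_ ?_ ?_ ?_
  · rcases hiβ with h | h
    · exact (HasSegment.seg (by omega) (by omega) (by omega)).append_left _
    · exact (HasSegment.seg (by omega) (by omega) (by omega)).reverse.append_right _
  all_goals simp only [List.length_append, List.length_reverse, length_seg, Nat.even_iff]; omega

theorem closing_rotated_left {i k : ℕ} (hpar : (t - s) % 2 = 0)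
    (hi' : i + 8 ≤ ℓ) (hiβ : i + 4 ≤ β ∨ β + 18 ≤ i) (h1 : H.Adj (f s) (f (i + 2)))
    (hk : 8 ≤ k) (hki : k + 2 ≤ i) (hkβ : k + 4 ≤ β ∨ β + 18 ≤ k)
    (h2 : H.Adj (f k) (f i)) (h3 : H.Adj (f (k + 2)) (f (t - 1))) :
    HasClosing H R (seg f β (β + 15)) ℓ := by
  refine (((IsRun.seg hf (i := k + 2) (j := i + 1) (by omega) (by omega)).rev.append hf
    (IsRun.seg hf (i := i + 2) (j := t) (by omega) ht).rev h3
    (fun j _ _ => by omega)).append hf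
    (IsRun.seg hf (i := s) (j := k + 1) (by omega) (by omega)) h1.symm
    (fun j _ _ => by omega)).closing hf (by simpa using h2) ?_ ?_ ?_ ?_
  · rcases hiβ with h | h
    · exact ((HasSegment.seg (by omega) (by omega) (by omega)).reverse.append_left _).append_right _
    rcases hkβ with h' | h'
    · exact ((HasSegment.seg (by omega) (by omega)
        (by omega)).reverse.append_right _).append_right _
    · exact (HasSegment.seg (by omega) (by omega) (by omega)).append_left _
  all_goals simp only [List.length_append, List.length_reverse, length_seg, Nat.even_iff]; omega

theorem closing_rotated_right {i k : ℕ} (hpar : (t - s) % 2 = 0) (hi : 8 ≤ i)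
    (hiβ : i + 4 ≤ β ∨ β + 18 ≤ i) (h1 : H.Adj (f s) (f (i + 2)))
    (hk : k + 8 ≤ ℓ) (hki : i + 4 ≤ k) (hkβ : k + 4 ≤ β ∨ β + 18 ≤ k)
    (h2 : H.Adj (f k) (f i)) (h3 : H.Adj (f (k - 2)) (f (t - 1))) :
    HasClosing H R (seg f β (β + 15)) ℓ := by
  refine (((IsRun.seg hf (i := s) (j := i + 1) (by omega) (by omega)).rev.append hf
    (IsRun.seg hf (i := i + 2) (j := k - 1) (by omega) (by omega)) h1
    (fun j _ _ => by omega)).append hf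
    (IsRun.seg hf (i := k) (j := t) (by omega) (by omega)).rev
    (by simpa [Nat.sub_sub] using h3)
    (fun j _ _ => by omega)).closing hf (by simpa using h2) ?_ ?_ ?_ ?_
  · rcases hkβ with h | h
    · exact (HasSegment.seg (by omega) (by omega) (by omega)).reverse.append_left _
    rcases hiβ with h' | h'
    · exact ((HasSegment.seg (by omega) (by omega) (by omega)).append_left _).append_right _
    · exact ((HasSegment.seg (by omega) (by omega)
        (by omega)).reverse.append_right _).append_right _
  all_goals simp only [List.length_append, List.length_reverse, length_seg, Nat.even_iff]; omega

end

end IsTrack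

end Track

section Struct

set_option linter.unusedSectionVars false

variable {V : Type*} [Fintype V] [DecidableEq V] {H : SimpleGraph V} {n : ℕ}

/-- `X`, `Y` and `C₀`, `C₁` are large, `X` and `C₀` as well as `Y` and `C₁` span induced matchings
between them, and `X` misses `C₁` as `Y` misses `C₀`. -/
structure HasSparsePairs (H : SimpleGraph V) (n : ℕ) (X Y C₀ C₁ : Finset V) : Prop where
  card_X : n ≤ X.card + 133
  card_Y : n ≤ Y.card + 133
  card_C₀ : n ≤ C₀.card + 153
  card_C₁ : n ≤ C₁.card + 153
  disjoint_X : Disjoint X C₁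
  disjoint_Y : Disjoint Y C₀
  right_X : ∀ x ∈ X, (nb H x ∩ C₀).card ≤ 1
  left_X : ∀ c ∈ C₀, (nb H c ∩ X).card ≤ 1
  right_Y : ∀ y ∈ Y, (nb H y ∩ C₁).card ≤ 1
  left_Y : ∀ c ∈ C₁, (nb H c ∩ Y).card ≤ 1

theorem HasSparsePairs.anti {K : SimpleGraph V} {X Y C₀ C₁ : Finset V} (hHK : H ≤ K)
    (h : HasSparsePairs K n X Y C₀ C₁) : HasSparsePairs H n X Y C₀ C₁ := by
  have hm : ∀ x (S : Finset V), (nb H x ∩ S).card ≤ (nb K x ∩ S).card := fun x S =>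
    Finset.card_le_card (Finset.inter_subset_inter_right fun z hz => mem_nb.2 (hHK (mem_nb.1 hz)))
  exact { h with
    right_X := fun x hx => (hm _ _).trans (h.right_X x hx)
    left_X := fun x hx => (hm _ _).trans (h.left_X x hx)
    right_Y := fun x hx => (hm _ _).trans (h.right_Y x hx)
    left_Y := fun x hx => (hm _ _).trans (h.left_Y x hx) }

namespace IsTrack

variable {R : Finset V} {f : ℕ → V} {ℓ β s e : ℕ}

/-- Neighbours of the vertices with indices `s` and `s + 2`. -/
noncomputable def startNb (H : SimpleGraph V) (f : ℕ → V) (s : ℕ) : Finset V :=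
  nb H (f s) ∪ nb H (f (s + 2))

/-- Neighbours of the vertices with indices `ℓ - 1 - e` and `ℓ - 3 - e`. -/
noncomputable def endNb (H : SimpleGraph V) (f : ℕ → V) (ℓ e : ℕ) : Finset V :=
  nb H (f (ℓ - e - 1)) ∪ nb H (f (ℓ - e - 2 - 1))

/-- Indices that are neither close to the ends nor to the segment starting at `β`. -/
def Far (ℓ β i : ℕ) : Prop := 12 ≤ i ∧ i + 12 ≤ ℓ ∧ (i + 8 ≤ β ∨ β + 22 ≤ i)

instance (ℓ β i : ℕ) : Decidable (Far ℓ β i) := by unfold Far; infer_instance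

/-- The vertices all of whose rotations start next to `f s`. -/
def IsFront (H : SimpleGraph V) (R : Finset V) (f : ℕ → V) (ℓ β s : ℕ) (x : V) : Prop :=
  (Outside R f ℓ x ∧ x ∈ startNb H f s) ∨
    ∃ i, Far ℓ β i ∧ f i = x ∧ f (i + 2) ∈ startNb H f s ∧ f (i + 4) ∈ startNb H f s

/-- The vertices that together with their second neighbours on the path are adjacent to its
end. -/
def IsCore (H : SimpleGraph V) (R : Finset V) (f : ℕ → V) (ℓ β e : ℕ) (c : V) : Prop :=
  (Outside R f ℓ c ∧ c ∈ endNb H f ℓ e) ∨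
    ∃ k, Far ℓ β k ∧ f k = c ∧ f (k - 2) ∈ endNb H f ℓ e ∧ f k ∈ endNb H f ℓ e ∧
      f (k + 2) ∈ endNb H f ℓ e

theorem mem_startNb {y : V} :
    y ∈ startNb H f s ↔ ∃ s', (s' = s ∨ s' = s + 2) ∧ H.Adj (f s') y := by
  simp [startNb]

theorem mem_endNb {y : V} :
    y ∈ endNb H f ℓ e ↔ ∃ t, (t = ℓ - e ∨ t = ℓ - e - 2) ∧ H.Adj (f (t - 1)) y := by
  simp [endNb]

section

variable (hf : IsTrack H R f ℓ) (hβ : 12 ≤ β) (hβ' : β + 27 ≤ ℓ) (hℓ : Even ℓ)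
  (hcl : ¬ HasClosing H R (seg f β (β + 15)) ℓ) (hs : s ≤ 1) (he : e ≤ 1)

include hf hβ hβ' hℓ hcl hs he

theorem notMem_endNb_of_outside (hse : (s + e) % 2 = 1) {z : V} (hz : Outside R f ℓ z)
    (h1 : z ∈ startNb H f s) : z ∉ endNb H f ℓ e := fun h2 => by
  obtain ⟨s', hs', h1⟩ := mem_startNb.1 h1
  obtain ⟨t, ht, h2⟩ := mem_endNb.1 h2
  have hℓ' := Nat.even_iff.1 hℓ
  exact hcl (hf.closing_outside (s := s') (t := t) (by omega) (by omega) (by omega) hβ hβ' hℓ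
    (by omega) hz h1.symm h2)

theorem notMem_endNb_of_crossing (hse : (s + e) % 2 = 1) {k σ : ℕ} (hσ : σ = 2 ∨ σ = 4)
    (hk : 8 ≤ k) (hk' : k + 4 ≤ ℓ) (hkβ : k ≤ β ∨ β + 18 ≤ k) (h1 : f k ∈ startNb H f s) :
    f (k - σ) ∉ endNb H f ℓ e := fun h2 => by
  obtain ⟨s', hs', h1⟩ := mem_startNb.1 h1
  obtain ⟨t, ht, h2⟩ := mem_endNb.1 h2
  have hℓ' := Nat.even_iff.1 hℓ
  exact hcl (hf.closing_crossing (s := s') (t := t) (by omega) (by omega) (by omega) hβ hβ' hℓ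
    (by omega) hσ hk hk' hkβ h1.symm h2.symm)

theorem not_isCore_of_isFront (hse : (s + e) % 2 = 1) {x : V} (h1 : IsFront H R f ℓ β s x) :
    ¬ IsCore H R f ℓ β e x := fun h2 => by
  rcases h1 with ⟨hx, h1⟩ | ⟨i, hi, rfl, h1, -⟩
  · rcases h2 with ⟨-, h2⟩ | ⟨k, hk, rfl, -⟩
    · exact notMem_endNb_of_outside hf hβ hβ' hℓ hcl hs he hse hx h1 h2
    · exact hx.2 k (by have := hk.2.1; omega) rfl
  · obtain ⟨hi1, hi2, hi3⟩ := hi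
    rcases h2 with ⟨hx, h2⟩ | ⟨k, ⟨hk1, hk2, hk3⟩, hki, h2⟩
    · exact hx.2 i (by omega) rfl
    · obtain rfl := hf.inj _ (by omega) _ (by omega) hki
      exact notMem_endNb_of_crossing hf hβ hβ' hℓ hcl hs he hse (k := k + 2) (Or.inl rfl)
        (by omega) (by omega) (by omega) h1 (by simpa using h2.2.1)

theorem eq_of_adj_of_isFront_of_isCore (hse : (s + e) % 2 = 0) {x c : V}
    (hx : IsFront H R f ℓ β s x) (hc : IsCore H R f ℓ β e c) (hxc : H.Adj x c) :
    ∃ i, 12 ≤ i ∧ i < ℓ ∧ f i = x ∧ f (i - 1) = c := by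
  have hℓ' := Nat.even_iff.1 hℓ
  have aux : ∀ s' t, (s' = s ∨ s' = s + 2) → (t = ℓ - e ∨ t = ℓ - e - 2) →
      s' ≤ 3 ∧ t ≤ ℓ ∧ ℓ ≤ t + 3 ∧ (t - s') % 2 = 0 := by
    intro s' t h1 h2
    refine ⟨?_, ?_, ?_, ?_⟩ <;> omega
  rcases hx with ⟨hx, h1⟩ | ⟨i, hi, rfl, h1, h1'⟩
  · obtain ⟨s', hs', h1⟩ := mem_startNb.1 h1
    rcases hc with ⟨hc, h2⟩ | ⟨k, ⟨hk1, hk2, hk3⟩, rfl, h2, -⟩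
    · obtain ⟨t, ht, h2⟩ := mem_endNb.1 h2
      obtain ⟨a1, a2, a3, a4⟩ := aux s' t hs' ht
      exact absurd (hf.closing_two_outside a1 a2 a3 hβ hβ' hℓ a4 hx hc h1.symm h2 hxc.symm) hcl
    · obtain ⟨t, ht, h2⟩ := mem_endNb.1 h2
      obtain ⟨a1, a2, a3, a4⟩ := aux s' t hs' ht
      exact absurd (hf.closing_outside_crossing a1 a2 a3 hβ hβ' hℓ a4 (k := k) (by omega)
        (by omega) (by omega) hx h1.symm h2.symm hxc.symm) hcl
  · obtain ⟨hi1, hi2, hi3⟩ := hi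
    obtain ⟨s', hs', h1⟩ := mem_startNb.1 h1
    obtain ⟨s'', hs'', h1'⟩ := mem_startNb.1 h1'
    rcases hc with ⟨hc, h2⟩ | ⟨k, ⟨hk1, hk2, hk3⟩, rfl, h2, h2', h2''⟩
    · obtain ⟨t, ht, h2⟩ := mem_endNb.1 h2
      obtain ⟨a1, a2, a3, a4⟩ := aux s' t hs' ht
      exact absurd (hf.closing_rotated a1 a2 a3 hβ hβ' hℓ a4 (Or.inl rfl) (by omega)
        (by omega) (by omega) h1 hc.1 (fun k hk _ => hc.2 k hk) hxc.symm h2) hcl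
    · by_cases hki : k + 2 ≤ i
      · obtain ⟨t, ht, h2⟩ := mem_endNb.1 h2''
        obtain ⟨a1, a2, a3, a4⟩ := aux s' t hs' ht
        exact absurd (hf.closing_rotated_left a1 a2 a3 hβ hβ' hℓ a4 (i := i) (k := k) (by omega)
          (by omega) h1 (by omega) hki (by omega) hxc.symm h2.symm) hcl
      by_cases hki' : i + 4 ≤ k
      · obtain ⟨t, ht, h2⟩ := mem_endNb.1 h2
        obtain ⟨a1, a2, a3, a4⟩ := aux s' t hs' ht
        exact absurd (hf.closing_rotated_right a1 a2 a3 hβ hβ' hℓ a4 (i := i) (k := k) (by omega)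
          (by omega) h1 (by omega) hki' (by omega) hxc.symm h2.symm) hcl
      by_cases hlt : i < k
      · obtain ⟨t, ht, h2⟩ := mem_endNb.1 h2'
        obtain ⟨a1, a2, a3, a4⟩ := aux s'' t hs'' ht
        refine absurd (hf.closing_rotated a1 a2 a3 hβ hβ' hℓ a4 (i := i) (Or.inr rfl) (by omega)
          (by omega) (by omega) h1' (hf.notMem k (by omega)) (fun j hj hj' h => ?_) hxc.symm h2) hcl
        have := hf.inj _ hj _ (by omega) h
        omega
      · have hne : i ≠ k := fun h => hxc.ne (by rw [h])
        exact ⟨i, hi1, by omega, rfl, by congr 1; omega⟩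

end

end IsTrack

end Struct

section Count

set_option linter.unusedSectionVars false

variable {V : Type*} [Fintype V] [DecidableEq V] {H : SimpleGraph V} {n : ℕ}

theorem card_filter_not_far_le (ℓ β : ℕ) (T : Finset ℕ) (hT : ∀ i ∈ T, i < ℓ) :
    T.card ≤ (T.filter (IsTrack.Far ℓ β)).card + 52 := by
  have h1 : T ⊆ T.filter (IsTrack.Far ℓ β) ∪
      (Finset.range 12 ∪ Finset.Ico (ℓ - 11) ℓ ∪ Finset.Ico (β - 7) (β + 22)) := by
    intro i hi
    have := hT i hi
    simp only [Finset.mem_union, Finset.mem_filter, hi, true_and, IsTrack.Far, Finset.mem_range,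
      Finset.mem_Ico]
    omega
  have h2 := Finset.card_le_card h1
  have h3 := Finset.card_union_le (T.filter (IsTrack.Far ℓ β))
    (Finset.range 12 ∪ Finset.Ico (ℓ - 11) ℓ ∪ Finset.Ico (β - 7) (β + 22))
  have h4 := Finset.card_union_le (Finset.range 12 ∪ Finset.Ico (ℓ - 11) ℓ)
    (Finset.Ico (β - 7) (β + 22))
  have h5 := Finset.card_union_le (Finset.range 12) (Finset.Ico (ℓ - 11) ℓ)
  simp only [Nat.card_Ico, Finset.card_range] at h3 h4 h5
  omega

theorem card_image_sub {T : Finset ℕ} {a : ℕ} (hT : ∀ i ∈ T, a ≤ i) :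
    (T.image fun i => i - a).card = T.card :=
  Finset.card_image_of_injOn fun i hi j hj hij => by
    have := hT i hi
    have := hT j hj
    omega

section

variable {ℓ β : ℕ} {I J : Finset ℕ} (hI : ∀ i ∈ I, i < ℓ) (hJ : ∀ i ∈ J, i < ℓ)
  (hIJ : ∀ i ∈ I, 8 ≤ i → i + 4 ≤ ℓ → (i ≤ β ∨ β + 18 ≤ i) → i - 2 ∉ J ∧ i - 4 ∉ J)

include hI hJ hIJ

theorem exists_card_core : ∃ I' ⊆ I, I.card ≤ I'.card + 28 ∧
    ∀ i ∈ I', 8 ≤ i ∧ i - 2 ∉ J ∧ i - 4 ∉ J := by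
  refine ⟨I.filter fun i => 8 ≤ i ∧ i + 4 ≤ ℓ ∧ (i ≤ β ∨ β + 18 ≤ i), Finset.filter_subset _ _,
    ?_, fun i hi => ?_⟩
  · have h1 : I ⊆ I.filter (fun i => 8 ≤ i ∧ i + 4 ≤ ℓ ∧ (i ≤ β ∨ β + 18 ≤ i)) ∪
        (Finset.range 8 ∪ Finset.Ico (ℓ - 3) ℓ ∪ Finset.Ico (β + 1) (β + 18)) := by
      intro i hi
      have := hI i hi
      simp only [Finset.mem_union, Finset.mem_filter, hi, true_and, Finset.mem_range,
        Finset.mem_Ico]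
      omega
    have h2 := Finset.card_le_card h1
    have h3 := Finset.card_union_le (I.filter fun i => 8 ≤ i ∧ i + 4 ≤ ℓ ∧ (i ≤ β ∨ β + 18 ≤ i))
      (Finset.range 8 ∪ Finset.Ico (ℓ - 3) ℓ ∪ Finset.Ico (β + 1) (β + 18))
    have h4 := Finset.card_union_le (Finset.range 8 ∪ Finset.Ico (ℓ - 3) ℓ)
      (Finset.Ico (β + 1) (β + 18))
    have h5 := Finset.card_union_le (Finset.range 8) (Finset.Ico (ℓ - 3) ℓ)
    simp only [Nat.card_Ico, Finset.card_range] at h3 h4 h5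
    omega
  · obtain ⟨h1, h2, h3, h4⟩ := Finset.mem_filter.1 hi
    exact ⟨h2, hIJ i h1 h2 h3 h4⟩

theorem card_front_indices : ∃ T : Finset ℕ, (∀ i ∈ T, IsTrack.Far ℓ β i ∧ i + 2 ∈ I ∧ i + 4 ∈ I) ∧
    2 * I.card + J.card ≤ T.card + ℓ + 108 := by
  obtain ⟨I', hI'I, hc, hI'⟩ := exists_card_core hI hJ hIJ
  set A := I'.image fun i => i - 2
  set B := I'.image fun i => i - 4
  have hA : A.card = I'.card := card_image_sub fun i hi => by have := (hI' i hi).1; omega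
  have hB : B.card = I'.card := card_image_sub fun i hi => by have := (hI' i hi).1; omega
  have hdisj : Disjoint (A ∪ B) J := by
    rw [Finset.disjoint_left]
    intro k hk
    rcases Finset.mem_union.1 hk with hk | hk <;> obtain ⟨i, hi, rfl⟩ := Finset.mem_image.1 hk
    · exact (hI' i hi).2.1
    · exact (hI' i hi).2.2
  have hle : (A ∪ B).card + J.card ≤ ℓ := by
    rw [← Finset.card_union_of_disjoint hdisj]
    have : (A ∪ B) ∪ J ⊆ Finset.range ℓ := by
      intro k hk
      rw [Finset.mem_range]
      rcases Finset.mem_union.1 hk with hk | hk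
      · rcases Finset.mem_union.1 hk with hk | hk <;>
          obtain ⟨i, hi, rfl⟩ := Finset.mem_image.1 hk <;>
          have := hI i (hI'I hi) <;> omega
      · exact hJ k hk
    simpa using Finset.card_le_card this
  have hAB := Finset.card_union_add_card_inter A B
  have hmem : ∀ i ∈ A ∩ B, i < ℓ ∧ i + 2 ∈ I ∧ i + 4 ∈ I := by
    intro k hk
    obtain ⟨h1, h2⟩ := Finset.mem_inter.1 hk
    obtain ⟨i, hi, rfl⟩ := Finset.mem_image.1 h1
    obtain ⟨j, hj, hij⟩ := Finset.mem_image.1 h2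
    have h8 := (hI' i hi).1
    have h8' := (hI' j hj).1
    have := hI i (hI'I hi)
    refine ⟨by omega, ?_, ?_⟩
    · rw [show i - 2 + 2 = i by omega]; exact hI'I hi
    · rw [show i - 2 + 4 = j by omega]; exact hI'I hj
  refine ⟨(A ∩ B).filter (IsTrack.Far ℓ β), fun i hi => ?_, ?_⟩
  · obtain ⟨h1, h2⟩ := Finset.mem_filter.1 hi
    exact ⟨h2, (hmem i h1).2⟩
  · have := card_filter_not_far_le ℓ β (A ∩ B) fun i hi => (hmem i hi).1
    omega

theorem card_core_indices : ∃ T : Finset ℕ,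
    (∀ i ∈ T, IsTrack.Far ℓ β i ∧ i - 2 ∈ J ∧ i ∈ J ∧ i + 2 ∈ J) ∧
    3 * J.card + 2 * I.card ≤ T.card + 2 * ℓ + 112 := by
  obtain ⟨I', hI'I, hc, hI'⟩ := exists_card_core hI hJ hIJ
  set J' := (J.filter (2 ≤ ·)).image fun i => i - 2
  set B := I'.image fun i => i - 4
  have hJ' : J.card ≤ J'.card + 2 := by
    have h1 : J'.card = (J.filter (2 ≤ ·)).card :=
      card_image_sub fun i hi => (Finset.mem_filter.1 hi).2
    have h2 : J ⊆ J.filter (2 ≤ ·) ∪ Finset.range 2 := by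
      intro i hi
      simp only [Finset.mem_union, Finset.mem_filter, hi, true_and, Finset.mem_range]
      omega
    have h3 := Finset.card_le_card h2
    have h4 := Finset.card_union_le (J.filter (2 ≤ ·)) (Finset.range 2)
    rw [Finset.card_range] at h4
    omega
  have hB : B.card = I'.card := card_image_sub fun i hi => by have := (hI' i hi).1; omega
  have hdisj : Disjoint (J ∪ J') B := by
    rw [Finset.disjoint_right]
    intro k hk hk'
    obtain ⟨i, hi, rfl⟩ := Finset.mem_image.1 hk
    have h8 := hI' i hi
    rcases Finset.mem_union.1 hk' with hk | hk
    · exact h8.2.2 hk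
    · obtain ⟨j, hj, hij⟩ := Finset.mem_image.1 hk
      obtain ⟨hj, hj2⟩ := Finset.mem_filter.1 hj
      exact h8.2.1 (by rwa [show i - 2 = j by omega])
  have hle : (J ∪ J').card + B.card ≤ ℓ := by
    rw [← Finset.card_union_of_disjoint hdisj]
    have : (J ∪ J') ∪ B ⊆ Finset.range ℓ := by
      intro k hk
      rw [Finset.mem_range]
      rcases Finset.mem_union.1 hk with hk | hk
      · rcases Finset.mem_union.1 hk with hk | hk
        · exact hJ k hk
        · obtain ⟨i, hi, rfl⟩ := Finset.mem_image.1 hk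
          have := hJ i (Finset.mem_filter.1 hi).1
          omega
      · obtain ⟨i, hi, rfl⟩ := Finset.mem_image.1 hk
        have := hI i (hI'I hi)
        omega
    simpa using Finset.card_le_card this
  have hJJ := Finset.card_union_add_card_inter J J'
  have hA1 : ∀ k ∈ J ∩ J', k ∈ J ∧ k + 2 ∈ J := by
    intro k hk
    obtain ⟨h1, h2⟩ := Finset.mem_inter.1 hk
    obtain ⟨j, hj, hij⟩ := Finset.mem_image.1 h2
    obtain ⟨hj, hj2⟩ := Finset.mem_filter.1 hj
    exact ⟨h1, by rwa [show k + 2 = j by omega]⟩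
  set A := J ∩ J'
  set A' := A.image (· + 2)
  have hA' : A'.card = A.card := Finset.card_image_of_injective _ (add_left_injective 2)
  have hAA := Finset.card_union_add_card_inter A A'
  have hAJ : (A ∪ A').card ≤ J.card := by
    refine Finset.card_le_card (Finset.union_subset Finset.inter_subset_left fun k hk => ?_)
    obtain ⟨j, hj, rfl⟩ := Finset.mem_image.1 hk
    exact (hA1 j hj).2
  have hmem : ∀ i ∈ A ∩ A', i - 2 ∈ J ∧ i ∈ J ∧ i + 2 ∈ J := by
    intro k hk
    obtain ⟨h1, h2⟩ := Finset.mem_inter.1 hk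
    obtain ⟨j, hj, rfl⟩ := Finset.mem_image.1 h2
    exact ⟨by simpa using (hA1 j hj).1, hA1 _ h1⟩
  refine ⟨(A ∩ A').filter (IsTrack.Far ℓ β), fun i hi => ?_, ?_⟩
  · obtain ⟨h1, h2⟩ := Finset.mem_filter.1 hi
    exact ⟨h2, hmem i h1⟩
  · have := card_filter_not_far_le ℓ β (A ∩ A') fun i hi => hJ i (hmem i hi).2.1
    omega

end

namespace IsTrack

variable {R : Finset V} {f : ℕ → V} {ℓ β : ℕ}

open Classical in
theorem card_le {S : Finset V} {I : Finset ℕ} (hI : ∀ k < ℓ, f k ∈ S → k ∈ I) :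
    S.card ≤ R.card + I.card + (Finset.univ.filter fun z => Outside R f ℓ z ∧ z ∈ S).card := by
  have h1 : S ⊆ R ∪ I.image f ∪ (Finset.univ.filter fun z => Outside R f ℓ z ∧ z ∈ S) := by
    intro z hz
    by_cases h : ∃ k < ℓ, f k = z
    · obtain ⟨k, hk, rfl⟩ := h
      exact Finset.mem_union_left _ (Finset.mem_union_right _ (Finset.mem_image_of_mem f
        (hI k hk hz)))
    · push Not at h
      by_cases hR : z ∈ R
      · exact Finset.mem_union_left _ (Finset.mem_union_left _ hR)
      · exact Finset.mem_union_right _ (Finset.mem_filter.2 ⟨Finset.mem_univ z, ⟨hR, h⟩, hz⟩)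
  have h2 := Finset.card_le_card h1
  have h3 := Finset.card_union_le (R ∪ I.image f)
    (Finset.univ.filter fun z => Outside R f ℓ z ∧ z ∈ S)
  have h4 := Finset.card_union_le R (I.image f)
  have h5 := Finset.card_image_le (s := I) (f := f)
  omega

open Classical in
theorem card_outside_le (hf : IsTrack H R f ℓ) :
    ℓ + (Finset.univ.filter fun z => Outside R f ℓ z).card ≤ Fintype.card V := by
  have h1 : ((Finset.range ℓ).image f).card = ℓ := by
    rw [Finset.card_image_of_injOn, Finset.card_range]
    intro i hi j hj
    exact hf.inj i (by simpa using hi) j (by simpa using hj)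
  have h2 : Disjoint ((Finset.range ℓ).image f) (Finset.univ.filter fun z => Outside R f ℓ z) := by
    rw [Finset.disjoint_left]
    intro z hz hz'
    obtain ⟨k, hk, rfl⟩ := Finset.mem_image.1 hz
    exact (Finset.mem_filter.1 hz').2.2 k (by simpa using hk) rfl
  have h3 := Finset.card_union_of_disjoint h2
  rw [h1] at h3
  exact h3 ▸ Finset.card_le_univ _

open Classical in
theorem card_image_add_card_outside_le (hf : IsTrack H R f ℓ) {T : Finset ℕ} (hT : ∀ k ∈ T, k < ℓ)
    {S P : Finset V} (hTP : ∀ k ∈ T, f k ∈ P) (hSP : ∀ z, Outside R f ℓ z → z ∈ S → z ∈ P) :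
    T.card + (Finset.univ.filter fun z => Outside R f ℓ z ∧ z ∈ S).card ≤ P.card := by
  have h1 : (T.image f).card = T.card := Finset.card_image_of_injOn fun i hi j hj =>
    hf.inj i (hT i hi) j (hT j hj)
  have h2 : Disjoint (T.image f) (Finset.univ.filter fun z => Outside R f ℓ z ∧ z ∈ S) := by
    rw [Finset.disjoint_left]
    intro z hz hz'
    obtain ⟨k, hk, rfl⟩ := Finset.mem_image.1 hz
    exact (Finset.mem_filter.1 hz').2.1.2 k (hT k hk) rfl
  rw [← h1, ← Finset.card_union_of_disjoint h2]
  refine Finset.card_le_card (Finset.union_subset (Finset.image_subset_iff.2 hTP) fun z hz => ?_)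
  obtain ⟨-, h3, h4⟩ := Finset.mem_filter.1 hz
  exact hSP z h3 h4

variable (hf : IsTrack H R f ℓ) (hβ : 12 ≤ β) (hβ' : β + 27 ≤ ℓ) (hℓ : Even ℓ)
  (hcl : ¬ HasClosing H R (seg f β (β + 15)) ℓ) (hH : PairDense H n) (hR : R.card ≤ 7)

include hf hβ hβ' hℓ hcl hH hR

open Classical in
theorem card_front_and_core {s e : ℕ} (hs : s ≤ 1) (he : e ≤ 1) (hse : (s + e) % 2 = 1) :
    n ≤ (Finset.univ.filter (IsFront H R f ℓ β s)).card + 133 ∧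
      n ≤ (Finset.univ.filter (IsCore H R f ℓ β e)).card + 153 := by
  set I := (Finset.range ℓ).filter fun k => f k ∈ startNb H f s
  set J := (Finset.range ℓ).filter fun k => f k ∈ endNb H f ℓ e
  have hI : ∀ i ∈ I, i < ℓ := fun i hi => Finset.mem_range.1 (Finset.mem_filter.1 hi).1
  have hJ : ∀ i ∈ J, i < ℓ := fun i hi => Finset.mem_range.1 (Finset.mem_filter.1 hi).1
  have hI' : ∀ i ∈ I, f i ∈ startNb H f s := fun i hi => (Finset.mem_filter.1 hi).2
  have hJ' : ∀ i ∈ J, f i ∈ endNb H f ℓ e := fun i hi => (Finset.mem_filter.1 hi).2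
  have hIJ : ∀ i ∈ I, 8 ≤ i → i + 4 ≤ ℓ → (i ≤ β ∨ β + 18 ≤ i) → i - 2 ∉ J ∧ i - 4 ∉ J :=
    fun i hi h1 h2 h3 =>
      ⟨fun h => notMem_endNb_of_crossing hf hβ hβ' hℓ hcl hs he hse (Or.inl rfl) h1 h2 h3 (hI' i hi)
        (hJ' _ h),
      fun h => notMem_endNb_of_crossing hf hβ hβ' hℓ hcl hs he hse (Or.inr rfl) h1 h2 h3 (hI' i hi)
        (hJ' _ h)⟩
  have hU := card_le (R := R) (f := f) (S := startNb H f s) (I := I) fun k hk h =>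
    Finset.mem_filter.2 ⟨Finset.mem_range.2 hk, h⟩
  have hW := card_le (R := R) (f := f) (S := endNb H f ℓ e) (I := J) fun k hk h =>
    Finset.mem_filter.2 ⟨Finset.mem_range.2 hk, h⟩
  have hU' : n ≤ (startNb H f s).card + 1 := hH.card_union fun h => by
    have := hf.inj _ (by omega) _ (by omega) h; omega
  have hW' : n ≤ (endNb H f ℓ e).card + 1 := hH.card_union fun h => by
    have := hf.inj _ (by omega) _ (by omega) h; omega
  have hD := hf.card_outside_le
  rw [hH.1] at hD
  have hUW : (Finset.univ.filter fun z => Outside R f ℓ z ∧ z ∈ startNb H f s).card +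
      (Finset.univ.filter fun z => Outside R f ℓ z ∧ z ∈ endNb H f ℓ e).card ≤
      (Finset.univ.filter fun z => Outside R f ℓ z).card := by
    rw [← Finset.card_union_of_disjoint]
    · refine Finset.card_le_card (Finset.union_subset ?_ ?_) <;>
        exact fun z hz => Finset.mem_filter.2 ⟨Finset.mem_univ z, (Finset.mem_filter.1 hz).2.1⟩
    · rw [Finset.disjoint_left]
      intro z hz hz'
      obtain ⟨-, h1, h2⟩ := Finset.mem_filter.1 hz
      exact notMem_endNb_of_outside hf hβ hβ' hℓ hcl hs he hse h1 h2 (Finset.mem_filter.1 hz').2.2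
  obtain ⟨T, hT, hTc⟩ := card_front_indices (β := β) hI hJ hIJ
  obtain ⟨T', hT', hTc'⟩ := card_core_indices (β := β) hI hJ hIJ
  have hX := hf.card_image_add_card_outside_le (T := T) (S := startNb H f s)
    (P := Finset.univ.filter (IsFront H R f ℓ β s))
    (fun k hk => by have := hI _ (hT k hk).2.1; omega)
    (fun k hk => Finset.mem_filter.2 ⟨Finset.mem_univ _,
      Or.inr ⟨k, (hT k hk).1, rfl, hI' _ (hT k hk).2.1, hI' _ (hT k hk).2.2⟩⟩)
    (fun z h1 h2 => Finset.mem_filter.2 ⟨Finset.mem_univ _, Or.inl ⟨h1, h2⟩⟩)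
  have hC := hf.card_image_add_card_outside_le (T := T') (S := endNb H f ℓ e)
    (P := Finset.univ.filter (IsCore H R f ℓ β e))
    (fun k hk => by have := hJ _ (hT' k hk).2.2.1; omega)
    (fun k hk => Finset.mem_filter.2 ⟨Finset.mem_univ _,
      Or.inr ⟨k, (hT' k hk).1, rfl, hJ' _ (hT' k hk).2.1, hJ' _ (hT' k hk).2.2.1,
        hJ' _ (hT' k hk).2.2.2⟩⟩)
    (fun z h1 h2 => Finset.mem_filter.2 ⟨Finset.mem_univ _, Or.inl ⟨h1, h2⟩⟩)
  constructor <;> omega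

open Classical in
theorem card_nb_inter_le {s e : ℕ} (hs : s ≤ 1) (he : e ≤ 1) (hse : (s + e) % 2 = 0) :
    (∀ x ∈ Finset.univ.filter (IsFront H R f ℓ β s),
      (nb H x ∩ Finset.univ.filter (IsCore H R f ℓ β e)).card ≤ 1) ∧
    ∀ c ∈ Finset.univ.filter (IsCore H R f ℓ β e),
      (nb H c ∩ Finset.univ.filter (IsFront H R f ℓ β s)).card ≤ 1 := by
  constructor
  · intro x hx
    refine Finset.card_le_one.2 fun a ha b hb => ?_
    simp only [Finset.mem_inter, mem_nb, Finset.mem_filter, Finset.mem_univ, true_and] at hx ha hb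
    obtain ⟨i, hi, hiℓ, rfl, rfl⟩ :=
      hf.eq_of_adj_of_isFront_of_isCore hβ hβ' hℓ hcl hs he hse hx ha.2 ha.1
    obtain ⟨j, hj, hjℓ, hji, rfl⟩ :=
      hf.eq_of_adj_of_isFront_of_isCore hβ hβ' hℓ hcl hs he hse hx hb.2 hb.1
    rw [hf.inj j hjℓ i hiℓ hji]
  · intro x hx
    refine Finset.card_le_one.2 fun a ha b hb => ?_
    simp only [Finset.mem_inter, mem_nb, Finset.mem_filter, Finset.mem_univ, true_and] at hx ha hb
    obtain ⟨i, hi, hiℓ, rfl, rfl⟩ :=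
      hf.eq_of_adj_of_isFront_of_isCore hβ hβ' hℓ hcl hs he hse ha.2 hx ha.1.symm
    obtain ⟨j, hj, hjℓ, rfl, hji⟩ :=
      hf.eq_of_adj_of_isFront_of_isCore hβ hβ' hℓ hcl hs he hse hb.2 hx hb.1.symm
    have := hf.inj (j - 1) (by omega) (i - 1) (by omega) hji
    rw [show i = j by omega]

open Classical in
theorem exists_sparsePairs : ∃ X Y C₀ C₁, HasSparsePairs H n X Y C₀ C₁ := by
  have h1 := hf.card_front_and_core hβ hβ' hℓ hcl hH hR (s := 0) (e := 1) (by omega) (by omega) rfl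
  have h2 := hf.card_front_and_core hβ hβ' hℓ hcl hH hR (s := 1) (e := 0) (by omega) (by omega) rfl
  have h3 := hf.card_nb_inter_le hβ hβ' hℓ hcl hH hR (s := 0) (e := 0) (by omega) (by omega) rfl
  have h4 := hf.card_nb_inter_le hβ hβ' hℓ hcl hH hR (s := 1) (e := 1) (by omega) (by omega) rfl
  refine ⟨_, _, _, _, ⟨h1.1, h2.1, h2.2, h1.2, ?_, ?_, h3.1, h3.2, h4.1, h4.2⟩⟩
  · refine Finset.disjoint_filter.2 fun x _ hx => ?_
    exact not_isCore_of_isFront hf hβ hβ' hℓ hcl (by omega) (by omega) rfl hx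
  · refine Finset.disjoint_filter.2 fun x _ hx => ?_
    exact not_isCore_of_isFront hf hβ hβ' hℓ hcl (by omega) (by omega) rfl hx

end IsTrack

end Count

section Cover

set_option linter.unusedSectionVars false

theorem HasSegment.of_append {V : Type*} {B s t : List V} {a b : V} (h : HasSegment B (s ++ t))
    (ha : s.getLast? = some a) (hb : t.head? = some b) (hab : a ∉ B ∨ b ∉ B) :
    HasSegment B s ∨ HasSegment B t := by
  have key : ∀ B' : List V, (∀ x ∈ B', x ∈ B) → B' <:+: s ++ t → B' <:+: s ∨ B' <:+: t := by
    intro B' hB' h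
    rcases List.infix_append_iff_ne_nil.1 h with h | h | ⟨p, q, hp, hq, rfl, hps, hqt⟩
    · exact Or.inl h
    · exact Or.inr h
    · exfalso
      obtain ⟨s', rfl⟩ := hps
      obtain ⟨t', rfl⟩ := hqt
      have h1 : a ∈ p := by
        rw [List.getLast?_append_of_ne_nil _ hp] at ha
        exact List.mem_of_getLast? ha
      have h2 : b ∈ q := by
        rw [List.head?_append_of_ne_nil _ hq] at hb
        exact List.mem_of_mem_head? hb
      rcases hab with hab | hab
      · exact hab (hB' _ (List.mem_append_left _ h1))
      · exact hab (hB' _ (List.mem_append_right _ h2))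
  have hr : ∀ l : List V, HasSegment B l ↔ B <:+: l ∨ B.reverse <:+: l := by
    intro l
    rw [HasSegment, ← List.reverse_infix (l₁ := B.reverse), List.reverse_reverse]
  rw [hr] at h
  rw [hr, hr]
  rcases h with h | h
  · rcases key B (fun _ h => h) h with h | h <;> simp [h]
  · rcases key B.reverse (fun _ h => List.mem_reverse.1 h) h with h | h <;> simp [h]

theorem countP_add_countP_le {V : Type*} (U W B : V → Bool) : ∀ (t : List V) (a : V),
    (∀ y ∈ (a :: t).getLast?, W y = false) →
    (∀ s x y t', a :: t = s ++ x :: y :: t' → U y = true → W x = true → B y = true) →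
    t.countP U + (a :: t).countP W + 1 ≤ (a :: t).length + t.countP B := by
  intro t
  induction t with
  | nil =>
    intro a h1 _
    have := h1 a (by simp)
    simp [this]
  | cons b t ih =>
    intro a h1 h2
    have h3 := ih b (fun y hy => h1 y (by simpa using hy)) fun s x y t' h => h2 (a :: s) x y t'
      (by simp [h])
    have h4 := h2 [] a b t rfl
    rw [List.countP_cons, List.countP_cons (a := a) (l := b :: t), List.countP_cons (p := B),
      List.length_cons]
    cases h5 : U b <;> cases h6 : W a <;> simp_all <;> omega

variable {V : Type*}

/-- The lists in `ps` are disjoint paths of `H` partitioning the complement of `R`, one of which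
contains `B`. -/
structure PathCover (H : SimpleGraph V) (R : Finset V) (B : List V) (ps : List (List V)) :
    Prop where
  chain : ∀ p ∈ ps, ∃ a b, ChainFromTo H a b p
  nodup : ps.flatten.Nodup
  mem : ∀ x, x ∈ ps.flatten ↔ x ∉ R
  seg : ∃ p ∈ ps, HasSegment B p

namespace PathCover

variable {H : SimpleGraph V} {R : Finset V} {B : List V} {ps : List (List V)}

theorem replace (h : PathCover H R B ps) {old new rest : List (List V)} (hps : ps.Perm (old ++ rest))
    (hnew : ∀ p ∈ new, ∃ a b, ChainFromTo H a b p) (hperm : new.flatten.Perm old.flatten)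
    (hseg : (∃ p ∈ old, HasSegment B p) → ∃ p ∈ new, HasSegment B p) :
    PathCover H R B (new ++ rest) := by
  have h1 : (new ++ rest).flatten.Perm ps.flatten := by
    refine List.Perm.trans ?_ hps.flatten.symm
    rw [List.flatten_append, List.flatten_append]
    exact hperm.append_right _
  refine ⟨fun p hp => ?_, h1.nodup_iff.2 h.nodup, fun x => by rw [h1.mem_iff, h.mem], ?_⟩
  · rcases List.mem_append.1 hp with hp | hp
    · exact hnew p hp
    · exact h.chain p (hps.mem_iff.2 (List.mem_append_right _ hp))
  · obtain ⟨p, hp, hB⟩ := h.seg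
    rcases List.mem_append.1 (hps.mem_iff.1 hp) with hp | hp
    · obtain ⟨q, hq, hB⟩ := hseg ⟨p, hp, hB⟩
      exact ⟨q, List.mem_append_left _ hq, hB⟩
    · exact ⟨p, List.mem_append_right _ hp, hB⟩

variable [DecidableEq V] (h : PathCover H R B ps)
  (hmin : ∀ qs, PathCover H R B qs → ps.length ≤ qs.length)

include h hmin

theorem not_replace {old new rest : List (List V)} (hps : ps.Perm (old ++ rest))
    (hnew : ∀ p ∈ new, ∃ a b, ChainFromTo H a b p) (hperm : new.flatten.Perm old.flatten)
    (hseg : (∃ p ∈ old, HasSegment B p) → ∃ p ∈ new, HasSegment B p)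
    (hlen : new.length < old.length) : False := by
  have h1 := hmin _ (h.replace hps hnew hperm hseg)
  have h2 := hps.length_eq
  simp only [List.length_append] at h1 h2
  omega

variable {p q r : List V} {a b a' b' : V}

theorem exists_perm_pair (hp : p ∈ ps) (hq : q ∈ ps) (hpq : p ≠ q) :
    ∃ rest, ps.Perm ([p, q] ++ rest) :=
  ⟨(ps.erase p).erase q, (List.perm_cons_erase hp).trans
    ((List.perm_cons_erase ((List.mem_erase_of_ne hpq.symm).2 hq)).cons p)⟩

theorem exists_perm_triple (hp : p ∈ ps) (hq : q ∈ ps) (hr : r ∈ ps) (hpq : p ≠ q) (hpr : p ≠ r)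
    (hqr : q ≠ r) : ∃ rest, ps.Perm ([p, q, r] ++ rest) := by
  have h1 := (List.mem_erase_of_ne hpq.symm).2 hq
  have h2 := (List.mem_erase_of_ne hqr.symm).2 ((List.mem_erase_of_ne hpr.symm).2 hr)
  exact ⟨((ps.erase p).erase q).erase r, (List.perm_cons_erase hp).trans
    (((List.perm_cons_erase h1).trans ((List.perm_cons_erase h2).cons q)).cons p)⟩

theorem not_adj_head (hp : p ∈ ps) (hq : q ∈ ps) (hpq : p ≠ q) (hpa : ChainFromTo H a b p)
    (hqa : ChainFromTo H a' b' q) : ¬ H.Adj a a' := by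
  intro hadj
  obtain ⟨rest, hr⟩ := h.exists_perm_pair hmin hp hq hpq
  refine h.not_replace hmin (new := [p.reverse ++ q]) hr ?_ ?_ ?_ (by simp)
  · simpa using ⟨_, _, hpa.rev.append hqa hadj⟩
  · simpa using (List.reverse_perm p).append_right q
  · rintro ⟨l, hl, hB⟩
    simp only [List.mem_cons, List.not_mem_nil, or_false, exists_eq_left] at hl ⊢
    rcases hl with rfl | rfl
    · exact hB.reverse.append_right _
    · exact hB.append_left _

theorem not_adj_last (hp : p ∈ ps) (hq : q ∈ ps) (hpq : p ≠ q) (hpa : ChainFromTo H a b p)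
    (hqa : ChainFromTo H a' b' q) : ¬ H.Adj b b' := by
  intro hadj
  obtain ⟨rest, hr⟩ := h.exists_perm_pair hmin hp hq hpq
  refine h.not_replace hmin (new := [p ++ q.reverse]) hr ?_ ?_ ?_ (by simp)
  · simpa using ⟨_, _, hpa.append hqa.rev hadj⟩
  · simpa using (List.reverse_perm q).append_left p
  · rintro ⟨l, hl, hB⟩
    simp only [List.mem_cons, List.not_mem_nil, or_false, exists_eq_left] at hl ⊢
    rcases hl with rfl | rfl
    · exact hB.append_right _
    · exact hB.reverse.append_left _

theorem not_adj_split (hp : p ∈ ps) (hq : q ∈ ps) (hpq : p ≠ q) (hpa : ChainFromTo H a b p)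
    (hqa : ChainFromTo H a' b' q) {s t : List V} {x y : V} (hr : s ++ x :: y :: t ∈ ps)
    (hxy : x ∉ B ∨ y ∉ B) (hay : H.Adj a y) (hxb : H.Adj x b') : False := by
  obtain ⟨s', hs'⟩ : ∃ s', s' = s ++ [x] := ⟨_, rfl⟩
  obtain ⟨t', ht'⟩ : ∃ t', t' = y :: t := ⟨_, rfl⟩
  have hst : s ++ x :: y :: t = s' ++ t' := by simp [hs', ht']
  rw [hst] at hr
  obtain ⟨c, d, hcd, hc, hd⟩ := h.chain _ hr
  obtain ⟨h1, h2, h3⟩ := List.isChain_append.1 hcd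
  have hsx : s'.getLast? = some x := by simp [hs']
  have hty : t'.head? = some y := by simp [ht']
  have hs : ChainFromTo H c x s' := ⟨h1, by rw [← hc]; cases s <;> simp [hs'], hsx⟩
  have ht : ChainFromTo H y d t' := ⟨h2, hty, by rw [← hd, List.getLast?_append_of_ne_nil]; simp [ht']⟩
  have hxy : HasSegment B (s' ++ t') → HasSegment B s' ∨ HasSegment B t' :=
    fun hB => hB.of_append hsx hty hxy
  by_cases hrp : s' ++ t' = p
  · obtain ⟨rest, hrest⟩ := h.exists_perm_pair hmin hp hq hpq
    have hca : c = a := by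
      have := hpa.2.1
      rw [← hrp, hc] at this
      exact Option.some.inj this
    subst hca
    refine h.not_replace hmin (new := [q ++ (s'.reverse ++ t')]) hrest ?_ ?_ ?_ (by simp)
    · simpa using ⟨_, _, hqa.append (hs.rev.append ht hay) hxb.symm⟩
    · subst hrp
      simp only [List.flatten_cons, List.flatten_nil, List.append_nil]
      exact List.perm_append_comm.trans (((List.reverse_perm s').append_right t').append_right q)
    · rintro ⟨l, hl, hB⟩
      simp only [List.mem_cons, List.not_mem_nil, or_false, exists_eq_left] at hl ⊢
      rcases hl with rfl | rfl
      · rw [← hrp] at hB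
        rcases hxy hB with hB | hB
        · exact (hB.reverse.append_right _).append_left _
        · exact (hB.append_left _).append_left _
      · exact hB.append_right _
  by_cases hrq : s' ++ t' = q
  · obtain ⟨rest, hrest⟩ := h.exists_perm_pair hmin hp hq hpq
    have hdb : d = b' := by
      have := hqa.2.2
      rw [← hrq, hd] at this
      exact Option.some.inj this
    subst hdb
    refine h.not_replace hmin (new := [s' ++ (t'.reverse ++ p)]) hrest ?_ ?_ ?_ (by simp)
    · simpa using ⟨_, _, hs.append (ht.rev.append hpa hay.symm) hxb⟩
    · subst hrq
      simp only [List.flatten_cons, List.flatten_nil, List.append_nil]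
      rw [← List.append_assoc]
      exact List.perm_append_comm.trans (((List.reverse_perm t').append_left s').append_left p)
    · rintro ⟨l, hl, hB⟩
      simp only [List.mem_cons, List.not_mem_nil, or_false, exists_eq_left] at hl ⊢
      rcases hl with rfl | rfl
      · exact (hB.append_left _).append_left _
      · rw [← hrq] at hB
        rcases hxy hB with hB | hB
        · exact hB.append_right _
        · exact (hB.reverse.append_right _).append_left _
  obtain ⟨rest, hrest⟩ := h.exists_perm_triple hmin hp hq hr hpq (Ne.symm hrp) (Ne.symm hrq)
  refine h.not_replace hmin (new := [p.reverse ++ t', s' ++ q.reverse]) hrest ?_ ?_ ?_ (by simp)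
  · simpa using ⟨⟨_, _, hpa.rev.append ht hay⟩, ⟨_, _, hs.append hqa.rev hxb⟩⟩
  · simp only [List.flatten_cons, List.flatten_nil, List.append_nil, List.append_assoc]
    refine ((List.reverse_perm p).append_right _).trans (List.Perm.append_left p ?_)
    refine (List.perm_append_comm.append_left _).trans ?_
    rw [← List.append_assoc, ← List.append_assoc]
    refine (((List.reverse_perm q).append_left t').append_right s').trans ?_
    rw [List.append_assoc, List.append_assoc]
    exact List.perm_append_comm_assoc _ _ _ |>.trans ((List.perm_append_comm).append_left q)
  · rintro ⟨l, hl, hB⟩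
    simp only [List.mem_cons, List.not_mem_nil, or_false, exists_eq_or_imp, exists_eq_left] at hl ⊢
    rcases hl with rfl | rfl | rfl
    · exact Or.inl (hB.reverse.append_right _)
    · exact Or.inr (hB.reverse.append_left _)
    · rcases hxy hB with hB | hB
      · exact Or.inr (hB.append_right _)
      · exact Or.inl (hB.append_left _)

end PathCover

end Cover

section Junction

set_option linter.unusedSectionVars false

variable {V : Type*} [Fintype V] [DecidableEq V] {H : SimpleGraph V} {n : ℕ} {R : Finset V}
  {B : List V} {ps : List (List V)}

theorem countP_flatten_add_le (U W B : V → Bool) (ps : List (List V))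
    (h : ∀ p ∈ ps, p.countP U + p.countP W + 1 ≤ p.length + p.countP B) :
    ps.flatten.countP U + ps.flatten.countP W + ps.length ≤
      ps.flatten.length + ps.flatten.countP B := by
  induction ps with
  | nil => simp
  | cons p ps ih =>
    have h1 := ih fun q hq => h q (List.mem_cons_of_mem _ hq)
    have h2 := h p List.mem_cons_self
    simp only [List.flatten_cons, List.countP_append, List.length_append, List.length_cons]
    omega

theorem card_le_countP {l : List V} {S : Finset V} (hl : ∀ x, x ∉ R → x ∈ l) :
    S.card ≤ R.card + l.countP fun x => decide (x ∈ S) := by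
  have h1 : S ⊆ R ∪ (l.filter fun x => decide (x ∈ S)).toFinset := by
    intro x hx
    by_cases hR : x ∈ R
    · exact Finset.mem_union_left _ hR
    · exact Finset.mem_union_right _ (by simpa using ⟨hl x hR, hx⟩)
  have h2 := Finset.card_le_card h1
  have h3 := Finset.card_union_le R (l.filter fun x => decide (x ∈ S)).toFinset
  have h4 := (l.filter fun x => decide (x ∈ S)).toFinset_card_le
  rw [List.countP_eq_length_filter]
  omega

namespace PathCover

theorem exists_minimal (hB : ∃ a b, ChainFromTo H a b B) (hBn : B.Nodup) (hBR : ∀ x ∈ B, x ∉ R) :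
    ∃ ps, PathCover H R B ps ∧ ∀ qs, PathCover H R B qs → ps.length ≤ qs.length := by
  classical
  have hex : ∃ k ps, PathCover H R B ps ∧ ps.length = k := by
    let T := Finset.univ.filter fun x => x ∉ R ∧ x ∉ B
    refine ⟨_, B :: T.toList.map fun x => [x], ⟨?_, ?_, ?_, ?_⟩, rfl⟩
    · intro p hp
      rcases List.mem_cons.1 hp with rfl | hp
      · exact hB
      · obtain ⟨x, -, rfl⟩ := List.mem_map.1 hp
        exact ⟨x, x, ChainFromTo.single H x⟩
    all_goals
      have hfl : (B :: T.toList.map fun x => [x]).flatten = B ++ T.toList := by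
        simp [List.flatten_eq_flatMap, List.flatMap_map]
    · rw [hfl, List.nodup_append']
      refine ⟨hBn, T.nodup_toList, fun x hx hx' => ?_⟩
      have := Finset.mem_filter.1 (Finset.mem_toList.1 hx')
      exact this.2.2 hx
    · intro x
      rw [hfl, List.mem_append, Finset.mem_toList, Finset.mem_filter]
      by_cases hx : x ∈ B
      · simp [hx, hBR x hx]
      · simp [hx]
    · exact ⟨B, List.mem_cons_self, Or.inl (List.infix_refl B)⟩
  obtain ⟨ps, hps, hlen⟩ := Nat.find_spec hex
  exact ⟨ps, hps, fun qs hqs => hlen ▸ Nat.find_min' hex ⟨qs, hqs, rfl⟩⟩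

theorem ne_of_pairwise {p q : List V} {a b : V} (hp : ChainFromTo H a b p) (h : p.Disjoint q) :
    p ≠ q := fun hpq => h hp.left_mem (hpq ▸ hp.left_mem)

theorem length_le (h : PathCover H R B ps)
    (hmin : ∀ qs, PathCover H R B qs → ps.length ≤ qs.length) (hH : PairDense H n)
    (hR : R.card ≤ 7) (hB : B.length ≤ 15) : ps.length ≤ 31 := by
  by_contra! hlen
  obtain ⟨A₁, A₂, B₁, B₂, rest, hps⟩ : ∃ A₁ A₂ B₁ B₂ rest, ps = A₁ :: A₂ :: B₁ :: B₂ :: rest := by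
    rcases ps with - | ⟨A₁, - | ⟨A₂, - | ⟨B₁, - | ⟨B₂, rest⟩⟩⟩⟩ <;> simp at hlen ⊢
  obtain ⟨a₁, _, hA₁⟩ := h.chain A₁ (by simp [hps])
  obtain ⟨a₂, _, hA₂⟩ := h.chain A₂ (by simp [hps])
  obtain ⟨_, b₁, hB₁⟩ := h.chain B₁ (by simp [hps])
  obtain ⟨_, b₂, hB₂⟩ := h.chain B₂ (by simp [hps])
  have hpw := (List.nodup_flatten.1 h.nodup).2
  rw [hps] at hpw
  simp only [List.pairwise_cons, List.mem_cons, forall_eq_or_imp] at hpw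
  obtain ⟨⟨d12, d13, d14, -⟩, ⟨d23, d24, -⟩, ⟨d34, -⟩, -⟩ := hpw
  have m₁ : A₁ ∈ ps := by simp [hps]
  have m₂ : A₂ ∈ ps := by simp [hps]
  have m₃ : B₁ ∈ ps := by simp [hps]
  have m₄ : B₂ ∈ ps := by simp [hps]
  have ha : a₁ ≠ a₂ := fun e => d12 hA₁.left_mem (e ▸ hA₂.left_mem)
  have hb : b₁ ≠ b₂ := fun e => d34 hB₁.right_mem (e ▸ hB₂.right_mem)
  have hhead : ∀ p ∈ ps, ∀ x y, ChainFromTo H x y p → x ∉ nb H a₁ ∪ nb H a₂ := by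
    have key : ∀ q ∈ ps, ∀ a b, ChainFromTo H a b q → ∀ p ∈ ps, ∀ x y, ChainFromTo H x y p →
        ¬ H.Adj a x := by
      intro q hq a b hqa p hp x y hpx hadj
      by_cases e : q = p
      · subst e
        have := hqa.2.1.symm.trans hpx.2.1
        exact hadj.ne (Option.some.inj this)
      · exact h.not_adj_head hmin hq hp e hqa hpx hadj
    intro p hp x y hpx hx
    rcases Finset.mem_union.1 hx with hx | hx
    · exact key _ m₁ _ _ hA₁ p hp x y hpx (mem_nb.1 hx)
    · exact key _ m₂ _ _ hA₂ p hp x y hpx (mem_nb.1 hx)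
  have hlast : ∀ p ∈ ps, ∀ x y, ChainFromTo H x y p → y ∉ nb H b₁ ∪ nb H b₂ := by
    have key : ∀ q ∈ ps, ∀ a b, ChainFromTo H a b q → ∀ p ∈ ps, ∀ x y, ChainFromTo H x y p →
        ¬ H.Adj b y := by
      intro q hq a b hqa p hp x y hpx hadj
      by_cases e : q = p
      · subst e
        have := hqa.2.2.symm.trans hpx.2.2
        exact hadj.ne (Option.some.inj this)
      · exact h.not_adj_last hmin hq hp e hqa hpx hadj
    intro p hp x y hpx hx
    rcases Finset.mem_union.1 hx with hx | hx
    · exact key _ m₃ _ _ hB₁ p hp x y hpx (mem_nb.1 hx)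
    · exact key _ m₄ _ _ hB₂ p hp x y hpx (mem_nb.1 hx)
  have hsplit : ∀ s x y t, s ++ x :: y :: t ∈ ps → y ∈ nb H a₁ ∪ nb H a₂ →
      x ∈ nb H b₁ ∪ nb H b₂ → y ∈ B := by
    intro s x y t hp hy hx
    by_contra hyB
    rcases Finset.mem_union.1 hy with hy | hy <;> rcases Finset.mem_union.1 hx with hx | hx <;>
      rw [mem_nb] at hx hy
    · exact h.not_adj_split hmin m₁ m₃ (ne_of_pairwise hA₁ d13) hA₁ hB₁ hp (Or.inr hyB) hy hx.symm
    · exact h.not_adj_split hmin m₁ m₄ (ne_of_pairwise hA₁ d14) hA₁ hB₂ hp (Or.inr hyB) hy hx.symm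
    · exact h.not_adj_split hmin m₂ m₃ (ne_of_pairwise hA₂ d23) hA₂ hB₁ hp (Or.inr hyB) hy hx.symm
    · exact h.not_adj_split hmin m₂ m₄ (ne_of_pairwise hA₂ d24) hA₂ hB₂ hp (Or.inr hyB) hy hx.symm
  set U := nb H a₁ ∪ nb H a₂ with hU
  set W := nb H b₁ ∪ nb H b₂ with hW
  have hsum := countP_flatten_add_le (fun x => decide (x ∈ U)) (fun x => decide (x ∈ W))
    (fun x => decide (x ∈ B)) ps fun p hp => by
      obtain ⟨x, y, hxy⟩ := h.chain p hp
      obtain ⟨t, rfl⟩ : ∃ t, p = x :: t := by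
        have := hxy.2.1
        rcases p with - | ⟨z, t⟩
        · simp at this
        · exact ⟨t, by simpa using this⟩
      have := countP_add_countP_le (fun x => decide (x ∈ U)) (fun x => decide (x ∈ W))
        (fun x => decide (x ∈ B)) t x (fun z hz => by
          have hz' : z = y := by
            have := hxy.2.2
            rw [Option.mem_def.1 hz] at this
            exact Option.some.inj this
          subst hz'
          simpa using hlast _ hp _ _ hxy) (fun s z w t' hst hw hz => by
          rw [hst] at hp
          simpa using hsplit s z w t' hp (by simpa using hw) (by simpa using hz))
      have hx : decide (x ∈ U) = false := by simpa using hhead _ hp _ _ hxy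
      rw [List.countP_cons (a := x) (l := t) (p := fun x => decide (x ∈ U)),
        List.countP_cons (a := x) (l := t) (p := fun x => decide (x ∈ B)), hx]
      simp only [Bool.false_eq_true, if_false]
      omega
  have h1 : n ≤ U.card + 1 := hH.card_union ha
  have h2 : n ≤ W.card + 1 := hH.card_union hb
  have h3 := card_le_countP (l := ps.flatten) (R := R) (S := U) fun x hx => (h.mem x).2 hx
  have h4 := card_le_countP (l := ps.flatten) (R := R) (S := W) fun x hx => (h.mem x).2 hx
  have h5 : ps.flatten.length ≤ 2 * n := hH.1 ▸ h.nodup.length_le_card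
  have h6 : ps.flatten.countP (fun x => decide (x ∈ B)) ≤ B.length := by
    rw [List.countP_eq_length_filter]
    exact ((h.nodup.filter _).subperm fun x hx => by simpa using (List.mem_filter.1 hx).2).length_le
  omega

end PathCover

theorem exists_isChain_sup_fromEdgeSet (B : List V) : ∀ (rest : List (List V)) (p₀ : List V),
    p₀.IsChain H.Adj → (∀ q ∈ rest, ∃ a b, ChainFromTo H a b q) → (p₀ ++ rest.flatten).Nodup →
    (∀ q ∈ rest, ∀ x ∈ q, x ∉ B) → ∃ M : Finset (Sym2 V), M.card ≤ rest.length ∧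
      (∀ e ∈ M, ∃ x ∈ e, x ∉ B) ∧
      (p₀ ++ rest.flatten).IsChain (H ⊔ fromEdgeSet (M : Set (Sym2 V))).Adj := by
  intro rest
  induction rest with
  | nil =>
    intro p₀ hp₀ _ _ _
    exact ⟨∅, by simp, by simp, by simpa using hp₀⟩
  | cons q rest ih =>
    intro p₀ hp₀ hrest hn hB
    rw [List.flatten_cons] at hn ⊢
    obtain ⟨a, b, hq⟩ := hrest q List.mem_cons_self
    obtain ⟨M, hM, hMB, hch⟩ := ih q hq.1 (fun r hr => hrest r (List.mem_cons_of_mem _ hr))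
      (List.nodup_append'.1 hn).2.1 fun r hr => hB r (List.mem_cons_of_mem _ hr)
    have mono : ∀ M' : Finset (Sym2 V), M ⊆ M' →
        (q ++ rest.flatten).IsChain (H ⊔ fromEdgeSet (M' : Set (Sym2 V))).Adj := by
      intro M' hM'
      refine hch.imp fun x y hxy => ?_
      exact sup_le_sup_left (fromEdgeSet_mono (Finset.coe_subset.2 hM')) H hxy
    rcases eq_or_ne p₀ [] with rfl | hne
    · exact ⟨M, by simp; omega, hMB, by simpa using hch⟩
    refine ⟨insert s(p₀.getLast hne, a) M, ?_, ?_, ?_⟩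
    · have := Finset.card_insert_le s(p₀.getLast hne, a) M
      simp only [List.length_cons]
      omega
    · intro e he
      rcases Finset.mem_insert.1 he with rfl | he
      · exact ⟨a, by simp, hB q List.mem_cons_self a hq.left_mem⟩
      · exact hMB e he
    · refine List.isChain_append.2 ⟨hp₀.imp fun x y hxy => Or.inl hxy,
        mono _ (Finset.subset_insert _ _), ?_⟩
      intro x hx y hy
      rw [List.getLast?_eq_some_getLast hne, Option.mem_some] at hx
      rw [List.head?_append, hq.2.1, Option.some_or, Option.mem_some] at hy
      subst hx hy
      refine Or.inr ((fromEdgeSet_adj _).2 ⟨by simp, fun e => ?_⟩)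
      exact (List.nodup_append'.1 hn).2.2 (List.getLast_mem hne)
        (e ▸ List.mem_append_left _ hq.left_mem)

theorem PairDense.exists_near_path (hH : PairDense H n) (hR : R.card ≤ 7) (hB15 : B.length ≤ 15)
    (hB : ∃ a b, ChainFromTo H a b B) (hBn : B.Nodup) (hBR : ∀ x ∈ B, x ∉ R) :
    ∃ (M : Finset (Sym2 V)) (l : List V), M.card ≤ 31 ∧ (∀ e ∈ M, ∃ x ∈ e, x ∉ B) ∧
      l.IsChain (H ⊔ fromEdgeSet (M : Set (Sym2 V))).Adj ∧ l.Nodup ∧ (∀ x ∈ l, x ∉ R) ∧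
      HasSegment B l ∧ 2 * n ≤ l.length + 7 := by
  obtain ⟨ps, hps, hmin⟩ := PathCover.exists_minimal hB hBn hBR
  have hlen := hps.length_le hmin hH hR hB15
  obtain ⟨p₀, hp₀, hseg⟩ := hps.seg
  have hperm := List.perm_cons_erase hp₀
  have hfl := hperm.flatten
  rw [List.flatten_cons] at hfl
  have hn := hfl.nodup_iff.1 hps.nodup
  have hBp : ∀ x ∈ B, x ∈ p₀ := fun x hx => by
    rcases hseg with h | h
    · exact h.subset hx
    · exact List.mem_reverse.1 (h.subset hx)
  obtain ⟨_, _, hc₀⟩ := hps.chain p₀ hp₀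
  obtain ⟨M, hM, hMB, hch⟩ := exists_isChain_sup_fromEdgeSet (H := H) B (ps.erase p₀) p₀ hc₀.1
    (fun q hq => hps.chain q (List.mem_of_mem_erase hq)) hn fun q hq x hx hxB =>
      (List.nodup_append'.1 hn).2.2 (hBp x hxB) (List.mem_flatten.2 ⟨q, hq, hx⟩)
  refine ⟨M, _, ?_, hMB, hch, hn, fun x hx => ?_, hseg.append_right _, ?_⟩
  · have := hperm.length_eq
    simp only [List.length_cons] at this
    omega
  · exact (hps.mem x).1 (hfl.mem_iff.2 hx)
  · have h1 := card_le_countP (l := ps.flatten) (R := R) (S := Finset.univ) fun x hx =>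
      (hps.mem x).2 hx
    have h2 := List.countP_le_length (l := ps.flatten) (p := fun x => decide (x ∈ Finset.univ))
    rw [Finset.card_univ, hH.1] at h1
    rw [← hfl.length_eq]
    omega

end Junction

section Stage

set_option linter.unusedSectionVars false

variable {V : Type*} [Fintype V] [DecidableEq V] {H : SimpleGraph V} {n : ℕ} {R : Finset V}
  {B : List V}

theorem seg_getD (l : List V) (d : V) {i j : ℕ} (hj : j ≤ l.length) :
    seg (fun k => l.getD k d) i j = (l.drop i).take (j - i) := by
  apply List.ext_getElem
  · simp only [length_seg, List.length_take, List.length_drop]; omega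
  · intro k h1 h2
    simp only [length_seg] at h1
    simp only [seg, List.getElem_map, List.getElem_range', List.getElem_take, List.getElem_drop,
      Nat.one_mul]
    exact List.getD_eq_getElem _ _ (by omega)

theorem isTrack_getD {l : List V} (d : V) (hl : l.IsChain H.Adj) (hn : l.Nodup)
    (hR : ∀ x ∈ l, x ∉ R) : IsTrack H R (fun k => l.getD k d) l.length where
  inj i hi j hj hij := by
    simp only [List.getD_eq_getElem _ _ hi, List.getD_eq_getElem _ _ hj] at hij
    exact (hn.getElem_inj_iff).1 hij
  notMem i hi := by
    simp only [List.getD_eq_getElem _ _ hi]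
    exact hR _ (List.getElem_mem _)
  adj i hi := by
    simp only [List.getD_eq_getElem _ _ hi, List.getD_eq_getElem _ _ (show i < l.length by omega)]
    exact List.isChain_iff_getElem.1 hl i hi

theorem exists_decomposition (Q : List V) (S : Finset V) (hS : 24 ≤ (S ∩ Q.toFinset).card)
    (hQ : Q.Nodup) : ∃ Q₁ y Q₂, Q = Q₁ ++ y :: Q₂ ∧ y ∈ S ∧ 12 ≤ Q₁.length ∧ 11 ≤ Q₂.length := by
  have hlen : 24 ≤ Q.length := by
    have := Finset.card_le_card (Finset.inter_subset_right (s₁ := S) (s₂ := Q.toFinset))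
    have := Q.toFinset_card_le
    omega
  obtain ⟨A, M, D, rfl, hA, hD⟩ : ∃ A M D, Q = A ++ (M ++ D) ∧ A.length = 12 ∧ D.length = 11 := by
    refine ⟨Q.take 12, (Q.drop 12).take (Q.length - 23), (Q.drop 12).drop (Q.length - 23), ?_, ?_, ?_⟩
    · rw [List.take_append_drop, List.take_append_drop]
    · rw [List.length_take]; omega
    · rw [List.length_drop, List.length_drop]; omega
  obtain ⟨y, hyM, hyS⟩ : ∃ y ∈ M, y ∈ S := by
    by_contra! h
    have h1 : S ∩ (A ++ (M ++ D)).toFinset ⊆ A.toFinset ∪ D.toFinset := by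
      intro x hx
      obtain ⟨hxS, hx⟩ := Finset.mem_inter.1 hx
      simp only [List.mem_toFinset, List.mem_append] at hx
      rcases hx with hx | hx | hx
      · exact Finset.mem_union_left _ (List.mem_toFinset.2 hx)
      · exact absurd hxS (h x hx)
      · exact Finset.mem_union_right _ (List.mem_toFinset.2 hx)
    have h2 := Finset.card_le_card h1
    have h3 := Finset.card_union_le A.toFinset D.toFinset
    have h4 := A.toFinset_card_le
    have h5 := D.toFinset_card_le
    omega
  obtain ⟨s, t, rfl⟩ := List.append_of_mem hyM
  exact ⟨A ++ s, y, t ++ D, by simp, hyS, by simp; omega, by simp; omega⟩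

theorem exists_centered_of_short_left (hdeg : ∀ x, x ∉ R → 500 ≤ (nb H x).card) {P Q : List V}
    (hB : B.length = 15) (hl : (P ++ (B ++ Q)).IsChain H.Adj) (hn : (P ++ (B ++ Q)).Nodup)
    (hR : ∀ x ∈ P ++ (B ++ Q), x ∉ R) (hlen : Fintype.card V ≤ (P ++ (B ++ Q)).length + 400)
    (hP : P.length < 12) : ∃ P' Q', (P' ++ (B ++ Q')).IsChain H.Adj ∧
      (P' ++ (B ++ Q')).Perm (P ++ (B ++ Q)) ∧ 12 ≤ P'.length ∧ 12 ≤ Q'.length := by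
  have hne : P ++ (B ++ Q) ≠ [] := by
    intro h; have := congrArg List.length h
    simp only [List.length_append, List.length_nil] at this; omega
  set x := (P ++ (B ++ Q)).head hne with hx
  have hxd := hdeg x (hR x (List.head_mem hne))
  obtain ⟨Q₁, y, Q₂, hQ, hy, h1, h2⟩ := exists_decomposition Q (nb H x) (by
    have h1 : nb H x ⊆ (Finset.univ \ (P ++ (B ++ Q)).toFinset) ∪ (P.toFinset ∪ B.toFinset) ∪
        (nb H x ∩ Q.toFinset) := by
      intro z hz
      simp only [Finset.mem_union, Finset.mem_sdiff, Finset.mem_univ, true_and, List.mem_toFinset,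
        List.mem_append, Finset.mem_inter, hz]
      tauto
    have h2 := Finset.card_le_card h1
    have h3 := Finset.card_union_le ((Finset.univ \ (P ++ (B ++ Q)).toFinset) ∪
      (P.toFinset ∪ B.toFinset)) (nb H x ∩ Q.toFinset)
    have h4 := Finset.card_union_le (Finset.univ \ (P ++ (B ++ Q)).toFinset)
      (P.toFinset ∪ B.toFinset)
    have h5 := Finset.card_union_le P.toFinset B.toFinset
    have h6 := P.toFinset_card_le
    have h7 := B.toFinset_card_le
    have h8 := Finset.card_sdiff_add_card_eq_card (Finset.subset_univ (P ++ (B ++ Q)).toFinset)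
    rw [List.toFinset_card_of_nodup hn, Finset.card_univ] at h8
    omega) (List.nodup_append'.1 (List.nodup_append'.1 hn).2.1).2.1
  subst hQ
  have e : P ++ (B ++ (Q₁ ++ y :: Q₂)) = (P ++ (B ++ Q₁)) ++ y :: Q₂ := by simp
  refine ⟨(y :: Q₂).reverse ++ P, Q₁, ?_, ?_, by simp; omega, h1⟩
  · rw [List.append_assoc]
    have hne' : P ++ (B ++ Q₁) ≠ [] := by
      intro h; have := congrArg List.length h
      simp only [List.length_append, List.length_nil] at this; omega
    rw [e] at hl
    obtain ⟨c1, c2, -⟩ := List.isChain_append.1 hl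
    have d1 := ChainFromTo.of_isChain c1 hne'
    have d2 := ChainFromTo.of_isChain c2 (List.cons_ne_nil y Q₂)
    refine (d2.rev.append d1 ?_).1
    have : (P ++ (B ++ Q₁)).head hne' = x := by
      apply Option.some.inj
      rw [hx, ← List.head?_eq_some_head, ← List.head?_eq_some_head, e,
        List.head?_append_of_ne_nil _ hne']
    rw [this]
    exact (mem_nb.1 hy).symm
  · rw [e, List.append_assoc]
    exact ((List.reverse_perm _).append_right _).trans List.perm_append_comm

theorem exists_centered (hdeg : ∀ x, x ∉ R → 500 ≤ (nb H x).card) {l : List V}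
    (hB : B.length = 15) (hl : l.IsChain H.Adj) (hn : l.Nodup) (hR : ∀ x ∈ l, x ∉ R)
    (hlen : Fintype.card V ≤ l.length + 400) (hseg : HasSegment B l) :
    ∃ P Q, (P ++ (B ++ Q)).IsChain H.Adj ∧ (P ++ (B ++ Q)).Perm l ∧ 12 ≤ P.length ∧
      12 ≤ Q.length := by
  wlog h : B <:+: l generalizing l
  · obtain ⟨P, Q, h1, h2, h3⟩ := this (l := l.reverse)
      (List.isChain_reverse.2 (hl.imp fun _ _ h => h.symm)) (List.nodup_reverse.2 hn)
      (by simpa using hR) (by simpa using hlen) hseg.reverse (hseg.resolve_left h)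
    exact ⟨P, Q, h1, h2.trans (List.reverse_perm l), h3⟩
  obtain ⟨P, Q, rfl⟩ := h
  rw [List.append_assoc] at *
  by_cases hP : P.length < 12
  · exact exists_centered_of_short_left hdeg hB hl hn hR hlen hP
  by_cases hQ : Q.length < 12
  · have e : Q.reverse ++ (B.reverse ++ P.reverse) = (P ++ (B ++ Q)).reverse := by simp
    obtain ⟨P', Q', h1, h2, h3, h4⟩ := exists_centered_of_short_left (P := Q.reverse)
      (B := B.reverse) (Q := P.reverse) hdeg (by simpa using hB)
      (e ▸ List.isChain_reverse.2 (hl.imp fun _ _ h => h.symm)) (e ▸ List.nodup_reverse.2 hn)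
      (fun x hx => hR x (List.mem_reverse.1 (e ▸ hx))) (by rw [e, List.length_reverse]; exact hlen)
      (by simpa using hQ)
    have e' : Q'.reverse ++ (B ++ P'.reverse) = (P' ++ (B.reverse ++ Q')).reverse := by simp
    refine ⟨Q'.reverse, P'.reverse, ?_, ?_, by simpa using h4, by simpa using h3⟩
    · rw [e']
      exact List.isChain_reverse.2 (h1.imp fun _ _ h => h.symm)
    · rw [e']
      exact (List.reverse_perm _).trans (h2.trans (e ▸ List.reverse_perm _))
  · exact ⟨P, Q, hl, List.Perm.refl _, by omega, by omega⟩

theorem exists_trimmed {P Q : List V} {t : ℕ} (hP : 12 ≤ P.length) (hQ : 12 ≤ Q.length)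
    (hB : B.length = 15) (ht : 39 ≤ t) (ht' : t ≤ (P ++ (B ++ Q)).length) :
    ∃ P' Q', P' ++ (B ++ Q') <:+: P ++ (B ++ Q) ∧ 12 ≤ P'.length ∧ 12 ≤ Q'.length ∧
      (P' ++ (B ++ Q')).length = t := by
  simp only [List.length_append] at ht'
  refine ⟨P.drop (P.length - min P.length (t - 27)), Q.take (t - 15 - min P.length (t - 27)),
    ⟨P.take (P.length - min P.length (t - 27)), Q.drop (t - 15 - min P.length (t - 27)), ?_⟩,
    ?_, ?_, ?_⟩
  · rw [← List.append_assoc, ← List.append_assoc, List.take_append_drop]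
    simp
  all_goals
    simp only [List.length_append, List.length_drop, List.length_take]
    omega

theorem PairDense.exists_closing (hH : PairDense H n) (hRc : R.card ≤ 7)
    (hdeg : ∀ x, x ∉ R → 500 ≤ (nb H x).card) {l : List V}
    (hB : B.length = 15) (hl : l.IsChain H.Adj) (hn : l.Nodup) (hR : ∀ x ∈ l, x ∉ R)
    (hlen : 2 * n ≤ l.length + 400) (hseg : HasSegment B l) {t : ℕ} (ht : 39 ≤ t)
    (ht' : t ≤ l.length) (hte : Even t) :
    (∃ X Y C₀ C₁, HasSparsePairs H n X Y C₀ C₁) ∨ HasClosing H R B t := by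
  by_contra! hcon
  obtain ⟨P, Q, h1, h2, h3, h4⟩ := exists_centered hdeg hB hl hn hR (hH.1 ▸ hlen) hseg
  obtain ⟨P', Q', h5, h6, h7, h8⟩ := exists_trimmed h3 h4 hB ht (h2.length_eq ▸ ht')
  obtain ⟨d⟩ : Nonempty V := ⟨l[0]⟩
  have hf := isTrack_getD (H := H) (R := R) (l := P' ++ (B ++ Q')) d (h1.infix h5)
    ((h2.nodup_iff.2 hn).sublist h5.sublist) fun x hx => hR x (h2.mem_iff.1 (h5.subset hx))
  have hs : seg (fun k => (P' ++ (B ++ Q')).getD k d) P'.length (P'.length + 15) = B := by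
    rw [seg_getD _ _ (by simp; omega)]
    simp [hB]
  rw [h8] at hf
  obtain ⟨X, Y, C₀, C₁, h⟩ := hf.exists_sparsePairs h6 (by simp at h8; omega) hte
    (by rw [hs]; exact hcon.2) hH hRc
  exact hcon.1 X Y C₀ C₁ h

end Stage

section Descent

set_option linter.unusedSectionVars false

variable {V : Type*} [Fintype V] [DecidableEq V] {H : SimpleGraph V} {n : ℕ} {R : Finset V}
  {B : List V} {M : Finset (Sym2 V)}

theorem adj_erase_of_ne {e : Sym2 V} {a b : V}
    (h : (H ⊔ fromEdgeSet (M : Set (Sym2 V))).Adj a b) (he : s(a, b) ≠ e) :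
    (H ⊔ fromEdgeSet ((M.erase e : Finset (Sym2 V)) : Set (Sym2 V))).Adj a b := by
  rcases h with h | h
  · exact Or.inl h
  · rw [fromEdgeSet_adj] at h
    exact Or.inr ((fromEdgeSet_adj _).2 ⟨by simpa using ⟨h.1, he⟩, h.2⟩)

theorem IsCyc.exists_erase {c : List V} (hc : IsCyc (H ⊔ fromEdgeSet (M : Set (Sym2 V))) c)
    (h3 : 3 ≤ c.length) (hB : HasSegment B c) {e : Sym2 V} (he : ∃ x ∈ e, x ∉ B) :
    ∃ (l : List V) (x y : V), l.Perm c ∧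
      ChainFromTo (H ⊔ fromEdgeSet ((M.erase e : Finset (Sym2 V)) : Set (Sym2 V))) x y l ∧
      (H ⊔ fromEdgeSet (M : Set (Sym2 V))).Adj y x ∧ HasSegment B l := by
  obtain ⟨hn, x, y, ⟨hc, hx, hy⟩, hyx⟩ := hc
  by_cases hch : c.IsChain (H ⊔ fromEdgeSet ((M.erase e : Finset (Sym2 V)) : Set (Sym2 V))).Adj
  · exact ⟨c, x, y, List.Perm.refl c, ⟨hch, hx, hy⟩, hyx, hB⟩
  rw [List.isChain_iff_forall_rel_of_append_cons_cons] at hch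
  push Not at hch
  obtain ⟨a, b, s, t, hst, hab⟩ := hch
  obtain ⟨s', hs'⟩ : ∃ s', s' = s ++ [a] := ⟨_, rfl⟩
  obtain ⟨t', ht'⟩ : ∃ t', t' = b :: t := ⟨_, rfl⟩
  have hst' : c = s' ++ t' := by simp [hst, hs', ht']
  have hsa : s'.getLast? = some a := by simp [hs']
  have htb : t'.head? = some b := by simp [ht']
  have hs0 : s' ≠ [] := by simp [hs']
  have ht0 : t' ≠ [] := by simp [ht']
  rw [hst'] at hc hx hy hn
  rw [List.head?_append_of_ne_nil _ hs0] at hx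
  rw [List.getLast?_append_of_ne_nil _ ht0] at hy
  obtain ⟨c1, c2, c3⟩ := List.isChain_append.1 hc
  have hadj := c3 a hsa b htb
  have hee : s(a, b) = e := by
    by_contra hne
    exact hab (adj_erase_of_ne hadj hne)
  obtain ⟨n1, n2, n3⟩ := List.nodup_append'.1 hn
  have hbs : b ∉ s' := fun h => n3 h (List.mem_of_mem_head? htb)
  have hat : a ∉ t' := fun h => n3 (List.mem_of_getLast? hsa) h
  have hlen : ¬ (s = [] ∧ t = []) := by
    rintro ⟨rfl, rfl⟩
    simp [hst] at h3
  refine ⟨t' ++ s', b, a, ?_, ⟨List.isChain_append.2 ⟨?_, ?_, ?_⟩, ?_, ?_⟩, hadj, ?_⟩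
  · rw [hst']; exact List.perm_append_comm
  · refine c2.imp_of_mem_imp fun u w hu hw huw => adj_erase_of_ne huw ?_
    rintro rfl
    rcases Sym2.eq_iff.1 hee with ⟨rfl, rfl⟩ | ⟨rfl, rfl⟩
    · exact hat hu
    · exact hat hw
  · refine c1.imp_of_mem_imp fun u w hu hw huw => adj_erase_of_ne huw ?_
    rintro rfl
    rcases Sym2.eq_iff.1 hee with ⟨rfl, rfl⟩ | ⟨rfl, rfl⟩
    · exact hbs hw
    · exact hbs hu
  · intro u hu w hw
    rw [hy, Option.mem_some] at hu
    rw [hx, Option.mem_some] at hw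
    subst hu hw
    refine adj_erase_of_ne hyx ?_
    rintro rfl
    rcases Sym2.eq_iff.1 hee with ⟨rfl, rfl⟩ | ⟨rfl, rfl⟩
    · exact hat (List.mem_of_getLast? hy)
    · refine hlen ⟨?_, ?_⟩
      · by_contra h0
        obtain ⟨z, s, rfl⟩ := List.exists_cons_of_ne_nil h0
        simp only [hs', List.cons_append, List.head?_cons, Option.some.injEq] at hx
        subst hx
        simp [hs'] at n1
      · by_contra h0
        have h1 := List.getLast_mem h0
        have h2 : t.getLast h0 = b := by
          have := hy
          rw [ht', List.getLast?_cons_of_ne_nil h0, List.getLast?_eq_some_getLast h0] at this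
          exact Option.some.inj this
        rw [ht', List.nodup_cons] at n2
        exact n2.1 (h2 ▸ h1)
  · rw [List.head?_append_of_ne_nil _ ht0, htb]
  · rw [List.getLast?_append_of_ne_nil _ hs0, hsa]
  · rw [hst'] at hB
    have hab' : a ∉ B ∨ b ∉ B := by
      obtain ⟨z, hz, hzB⟩ := he
      rw [← hee, Sym2.mem_iff] at hz
      rcases hz with rfl | rfl
      · exact Or.inl hzB
      · exact Or.inr hzB
    rcases hB.of_append hsa htb hab' with h | h
    · exact h.append_left _
    · exact h.append_right _

theorem PairDense.exists_path (hH : PairDense H n) (hn : 4511 ≤ n) (hRc : R.card ≤ 7)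
    (hdeg : ∀ x, x ∉ R → 500 ≤ (nb H x).card) (hB : B.length = 15) :
    ∀ (k : ℕ) (M : Finset (Sym2 V)) (l : List V), M.card = k → k ≤ 31 →
      (∀ e ∈ M, ∃ x ∈ e, x ∉ B) → l.IsChain (H ⊔ fromEdgeSet (M : Set (Sym2 V))).Adj → l.Nodup →
      (∀ x ∈ l, x ∉ R) → HasSegment B l → 2 * n + 9 * k ≤ l.length + 286 →
      (∃ X Y C₀ C₁, HasSparsePairs H n X Y C₀ C₁) ∨
        ∃ l : List V, l.IsChain H.Adj ∧ l.Nodup ∧ (∀ x ∈ l, x ∉ R) ∧ HasSegment B l ∧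
          2 * n ≤ l.length + 286 := by
  intro k
  induction k with
  | zero =>
    intro M l hM _ _ hl hln hR hseg hlen
    rw [Finset.card_eq_zero] at hM
    subst hM
    exact Or.inr ⟨l, by simpa using hl, hln, hR, hseg, by omega⟩
  | succ k ih =>
    intro M l hM hk hMB hl hln hR hseg hlen
    have hle : H ≤ H ⊔ fromEdgeSet (M : Set (Sym2 V)) := le_sup_left
    rcases (hH.mono hle).exists_closing hRc (fun x hx => (hdeg x hx).trans
      (Finset.card_le_card fun y hy => mem_nb.2 (hle (mem_nb.1 hy)))) hB hl hln hR (by omega) hseg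
      (t := l.length - l.length % 2) (by omega) (by omega) (by
        rw [Nat.even_iff]; omega) with ⟨X, Y, C₀, C₁, h⟩ | ⟨c, hc, hcR, hcB, -, h8, -⟩
    · exact Or.inl ⟨X, Y, C₀, C₁, h.anti hle⟩
    · obtain ⟨e, he⟩ : M.Nonempty := Finset.card_pos.1 (by omega)
      obtain ⟨l', _, _, hp, hl', -, hB'⟩ := hc.exists_erase (by omega) hcB (hMB e he)
      refine ih (M.erase e) l' (by rw [Finset.card_erase_of_mem he]; omega) (by omega)
        (fun e' he' => hMB e' (Finset.mem_of_mem_erase he')) hl'.1 (hp.nodup_iff.2 hc.1)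
        (fun x hx => hcR x (hp.mem_iff.1 hx)) hB' ?_
      rw [hp.length_eq]
      omega

theorem PairDense.hasCycleLength_or_exists_sparsePairs (hH : PairDense H n) (hn : 4511 ≤ n) {m : ℕ}
    (hm : Even m) (hm1 : n + 1 ≤ m) (hm2 : m ≤ 2 * n - 4008) :
    HasCycleLength H m ∨ ∃ X Y C₀ C₁, HasSparsePairs H n X Y C₀ C₁ := by
  obtain ⟨v, hv⟩ := hH.exists_exceptional (by omega)
  obtain ⟨g, hg, hgv⟩ := hH.exists_gadget hn v
  set E := (Finset.Ico 15 21).image g with hE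
  have hRc : (insert v E).card ≤ 7 := by
    have h1 := Finset.card_insert_le v E
    have h2 : E.card ≤ 6 := Finset.card_image_le
    omega
  have hdeg : ∀ x, x ∉ insert v E → 500 ≤ (nb H x).card := by
    intro x hx
    have := hv x fun h => hx (h ▸ Finset.mem_insert_self v E)
    omega
  have hBR : ∀ x ∈ seg g 0 15, x ∉ insert v E := by
    intro x hx hx'
    obtain ⟨i, -, hi, rfl⟩ := mem_seg.1 hx
    rcases Finset.mem_insert.1 hx' with h | h
    · exact hgv i (by omega) h
    · obtain ⟨j, hj, hji⟩ := Finset.mem_image.1 h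
      rw [Finset.mem_Ico] at hj
      have := hg.inj _ (by omega) _ (by omega) hji
      omega
  have hBn : (seg g 0 15).Nodup := nodup_seg fun a _ ha b _ hb => hg.inj a (by omega) b (by omega)
  have hBl : (seg g 0 15).length = 15 := by simp
  obtain ⟨M, l, hM, hMB, hl, hln, hR, hseg, hlen⟩ := hH.exists_near_path hRc hBl.le
    ⟨_, _, chainFromTo_seg (H := H) (f := g) (by omega) fun k _ hk => hg.adj k (by omega)⟩ hBn hBR
  rcases hH.exists_path hn hRc hdeg hBl _ M l rfl hM hMB hl hln hR hseg (by omega) with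
    h | ⟨l, hl, hln, hR, hseg, hlen⟩
  · exact Or.inr h
  have hm' := Nat.even_iff.1 hm
  rcases hH.exists_closing hRc hdeg hBl hl hln hR (by omega) hseg (t := m + 10) (by omega) (by omega)
    (Nat.even_iff.2 (by omega)) with h | ⟨c, hc, hcR, hcB, hce, h8, h2⟩
  · exact Or.inr h
  left
  have hce' := Nat.even_iff.1 hce
  obtain ⟨c', hc', hlen'⟩ := hg.exists_isCyc hc hcB (fun x hx hx' => by
    obtain ⟨j, hj, hj', rfl⟩ := mem_seg.1 hx'
    exact hcR _ hx (Finset.mem_insert_of_mem (Finset.mem_image_of_mem g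
      (Finset.mem_Ico.2 ⟨hj, hj'⟩)))) (r := (c.length - m) / 2) (by omega)
  have h := hc'.hasCycleLength (by omega)
  rwa [show c'.length = m by omega] at h

end Descent

section Ham

set_option linter.unusedSectionVars false

variable {V : Type*} [Fintype V] [DecidableEq V] {H K : SimpleGraph V} {S : Finset V}

theorem ChainFromTo.exists_crossing {x y : V} {l : List V} (hl : ChainFromTo K y x l) (hn : l.Nodup)
    (hS : ∀ z, z ∈ l ↔ z ∈ S) {Z : Finset V} (hZ : Z.card < (nb H x ∩ S).card + (nb H y ∩ S).card)
    (hxZ : nb H x ∩ S ⊆ Z)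
    (hyZ : ∀ p ∈ S, ∀ q ∈ S, K.Adj p q → H.Adj y q → p ∈ Z) :
    ∃ s t p q, l = s ++ t ∧ s.getLast? = some p ∧ t.head? = some q ∧ H.Adj x p ∧ H.Adj y q := by
  have hf := isTrack_getD (R := ∅) y hl.1 hn (by simp)
  have hval : ∀ i < l.length, l.getD i y ∈ S := fun i hi => by
    rw [List.getD_eq_getElem _ _ hi]; exact (hS _).1 (List.getElem_mem _)
  set I := (Finset.range (l.length - 1)).filter fun i => l.getD (i + 1) y ∈ nb H y with hI
  have hI' : ∀ i ∈ I, i + 1 < l.length ∧ H.Adj y (l.getD (i + 1) y) := fun i hi => by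
    obtain ⟨h1, h2⟩ := Finset.mem_filter.1 hi
    rw [Finset.mem_range] at h1
    exact ⟨by omega, mem_nb.1 h2⟩
  have h1 : (nb H y ∩ S).card ≤ I.card := by
    refine (Finset.card_le_card fun q hq => ?_).trans (Finset.card_image_le (s := I)
      (f := fun i => l.getD (i + 1) y))
    obtain ⟨hq, hqS⟩ := Finset.mem_inter.1 hq
    obtain ⟨j, hj, rfl⟩ := List.getElem_of_mem ((hS q).2 hqS)
    rcases j with - | j
    · have := hl.2.1
      rw [List.head?_eq_getElem?, List.getElem?_eq_getElem hj, Option.some.injEq] at this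
      rw [this] at hq
      exact absurd (mem_nb.1 hq) (H.loopless.irrefl y)
    · refine Finset.mem_image.2 ⟨j, Finset.mem_filter.2 ⟨Finset.mem_range.2 (by omega), ?_⟩, ?_⟩
      · rwa [List.getD_eq_getElem _ _ hj]
      · exact List.getD_eq_getElem _ _ hj
  have h2 : (I.image fun i => l.getD i y).card = I.card :=
    Finset.card_image_of_injOn fun i hi j hj hij =>
      hf.inj i (by have := hI' i hi; omega) j (by have := hI' j hj; omega) hij
  have h3 : I.image (fun i => l.getD i y) ⊆ Z := by
    intro p hp
    obtain ⟨i, hi, rfl⟩ := Finset.mem_image.1 hp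
    obtain ⟨hi1, hi2⟩ := hI' i hi
    exact hyZ _ (hval i (by omega)) _ (hval _ hi1) (hf.adj i hi1) hi2
  obtain ⟨p, hp⟩ : ((nb H x ∩ S) ∩ I.image fun i => l.getD i y).Nonempty := by
    rw [← Finset.card_pos]
    have := Finset.card_le_card (Finset.union_subset hxZ h3)
    have := Finset.card_union_add_card_inter (nb H x ∩ S) (I.image fun i => l.getD i y)
    omega
  obtain ⟨hp1, hp2⟩ := Finset.mem_inter.1 hp
  obtain ⟨i, hi, rfl⟩ := Finset.mem_image.1 hp2
  obtain ⟨hi1, hi2⟩ := hI' i hi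
  refine ⟨l.take (i + 1), l.drop (i + 1), _, _, (List.take_append_drop _ _).symm, ?_, ?_,
    mem_nb.1 (Finset.mem_inter.1 hp1).1, hi2⟩
  · rw [List.getLast?_take, List.getD_eq_getElem?_getD]
    simp [List.getElem?_eq_getElem (show i < l.length by omega)]
  · rw [List.head?_drop, List.getD_eq_getElem _ _ hi1, List.getElem?_eq_getElem hi1]

/-- A spanning cycle of `S` in `K` can be rerouted into one in `H` when the degrees in `H` are
large. -/
theorem exists_isCyc_of_card_lt (hHK : H ≤ K) {c₀ : List V} (hc₀ : IsCyc K c₀)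
    (hS : ∀ x, x ∈ c₀ ↔ x ∈ S) (h3 : 3 ≤ S.card)
    (hdeg : ∀ x ∈ S, ∀ y ∈ S, K.Adj x y → ∃ Z : Finset V,
      Z.card < (nb H x ∩ S).card + (nb H y ∩ S).card ∧ nb H x ∩ S ⊆ Z ∧
      ∀ p ∈ S, ∀ q ∈ S, K.Adj p q → H.Adj y q → p ∈ Z) :
    ∃ c, IsCyc H c ∧ ∀ x, x ∈ c ↔ x ∈ S := by
  classical
  have hex : ∃ (k : ℕ) (M : Finset (Sym2 V)), M.card = k ∧ (M : Set (Sym2 V)) ⊆ K.edgeSet ∧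
      ∃ c, IsCyc (H ⊔ fromEdgeSet (M : Set (Sym2 V))) c ∧ ∀ x, x ∈ c ↔ x ∈ S := by
    refine ⟨_, K.edgeFinset, rfl, by simp, c₀, hc₀.mono ?_, hS⟩
    simp
  obtain ⟨M, hM, hMK, c, hc, hcS⟩ := Nat.find_spec hex
  have hmin := fun M' : Finset (Sym2 V) => Nat.find_min' hex (m := Finset.card M')
  rw [← hM] at hmin
  have hle : ∀ M' ⊆ M, H ⊔ fromEdgeSet (M' : Set (Sym2 V)) ≤ K := fun M' h =>
    sup_le hHK ((fromEdgeSet_mono ((Finset.coe_subset.2 h).trans hMK)).trans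
      (by rw [fromEdgeSet_edgeSet]))
  rcases M.eq_empty_or_nonempty with rfl | ⟨e, he⟩
  · exact ⟨c, by simpa using hc, hcS⟩
  exfalso
  have hlen : c.length = S.card := by
    rw [← List.toFinset_card_of_nodup hc.1]
    congr 1
    ext x
    simp [hcS]
  obtain ⟨l, y, x, hp, hl, hxy, -⟩ := hc.exists_erase (B := []) (e := e) (by omega)
    (Or.inl List.nil_infix) (by
      induction e with | _ a b => exact ⟨a, by simp, by simp⟩)
  have hlS : ∀ z, z ∈ l ↔ z ∈ S := fun z => by rw [hp.mem_iff, hcS]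
  have hln := hp.nodup_iff.2 hc.1
  obtain ⟨Z, hZ, hxZ, hyZ⟩ := hdeg x ((hlS x).1 hl.right_mem) y ((hlS y).1 hl.left_mem)
    (hle M subset_rfl hxy)
  have hle' := hle _ (Finset.erase_subset e M)
  obtain ⟨s, t, p, q, rfl, hs, ht, hxp, hyq⟩ := (hl.mono hle').exists_crossing hln hlS hZ hxZ hyZ
  have hs0 : s ≠ [] := by rintro rfl; simp at hs
  have ht0 : t ≠ [] := by rintro rfl; simp at ht
  obtain ⟨hch, hy, hx⟩ := hl
  obtain ⟨c1, c2, -⟩ := List.isChain_append.1 hch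
  rw [List.head?_append_of_ne_nil _ hs0] at hy
  rw [List.getLast?_append_of_ne_nil _ ht0] at hx
  have d1 : ChainFromTo _ y p s := ⟨c1, hy, hs⟩
  have d2 : ChainFromTo _ q x t := ⟨c2, ht, hx⟩
  have hpm : (s ++ t.reverse).Perm (s ++ t) := (List.reverse_perm t).append_left s
  have := hmin (M.erase e) ⟨M.erase e, rfl, (Finset.coe_subset.2 (Finset.erase_subset e M)).trans
    hMK, s ++ t.reverse, ⟨hpm.nodup_iff.2 hln, y, q, d1.append d2.rev (Or.inl hxp.symm),
      Or.inl hyq.symm⟩, fun z => by rw [hpm.mem_iff, hlS]⟩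
  have := Finset.card_erase_lt_of_mem he
  omega

theorem IsCyc.adj_getD_mod {c : List V} (hc : IsCyc H c) (d : V) (k : ℕ) :
    H.Adj (c.getD (k % c.length) d) (c.getD ((k + 1) % c.length) d) := by
  obtain ⟨hn, a, b, hab, hba⟩ := hc
  have h0 : 0 < c.length := List.length_pos_iff.2 hab.ne_nil
  have hk := Nat.mod_lt k h0
  by_cases h : k % c.length + 1 < c.length
  · rw [Nat.add_mod_of_add_mod_lt] <;> rw [Nat.mod_eq_of_lt (show 1 < c.length by omega)]
    · exact (isTrack_getD (R := ∅) d hab.1 hn (by simp)).adj _ h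
    · exact h
  · have h1 : (k + 1) % c.length = 0 := by
      rw [Nat.add_mod]
      by_cases h1 : c.length = 1
      · rw [h1, Nat.mod_one]
      rw [Nat.mod_eq_of_lt (show 1 < c.length by omega),
        show k % c.length + 1 = c.length by omega, Nat.mod_self]
    rw [h1, show k % c.length = c.length - 1 by omega, List.getD_eq_getElem _ _ h0,
      List.getD_eq_getElem _ _ (by omega)]
    have ha := hab.2.1
    have hb := hab.2.2
    rw [List.head?_eq_getElem?, List.getElem?_eq_getElem h0, Option.some.injEq] at ha
    rw [List.getLast?_eq_getElem?, List.getElem?_eq_getElem (by omega), Option.some.injEq] at hb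
    rw [ha, hb]
    exact hba

theorem IsCyc.exists_window {c : List V} (hc : IsCyc H c) (hS : ∀ x, x ∈ c ↔ x ∈ S) {a₁ a₂ : V}
    {L : ℕ} (hL : 0 < L) (hL' : L ≤ S.card) {Z : Finset V}
    (hZ : Z.card < (nb H a₁ ∩ S).card + (nb H a₂ ∩ S).card) (h₁ : nb H a₁ ∩ S ⊆ Z)
    (h₂ : ∀ u u' w, ChainFromTo H u u' w → w.length = L → (∀ x ∈ w, x ∈ S) → H.Adj a₂ u' → u ∈ Z) :
    ∃ u u' w, ChainFromTo H u u' w ∧ w.Nodup ∧ (∀ x ∈ w, x ∈ S) ∧ w.length = L ∧ H.Adj a₁ u ∧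
      H.Adj a₂ u' := by
  have hlen : c.length = S.card := by
    rw [← List.toFinset_card_of_nodup hc.1]
    congr 1
    ext x
    simp [hS]
  set N := c.length with hN
  have hN0 : 0 < N := by omega
  set f : ℕ → V := fun k => c.getD (k % N) a₁ with hf
  have hadj : ∀ k, H.Adj (f k) (f (k + 1)) := hc.adj_getD_mod a₁
  have hfS : ∀ k, f k ∈ S := fun k => by
    have hk := Nat.mod_lt k hN0
    simp only [hf, List.getD_eq_getElem _ _ hk]
    exact (hS _).1 (List.getElem_mem _)
  have hinj : ∀ i j, f i = f j → i % N = j % N := fun i j hij => by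
    have hi := Nat.mod_lt i hN0
    have hj := Nat.mod_lt j hN0
    simp only [hf, List.getD_eq_getElem _ _ hi, List.getD_eq_getElem _ _ hj] at hij
    exact (hc.1.getElem_inj_iff).1 hij
  have hsurj : ∀ x ∈ S, ∃ k < N, f k = x := fun x hx => by
    obtain ⟨k, hk, rfl⟩ := List.getElem_of_mem ((hS x).2 hx)
    have hk' : k < N := hk
    refine ⟨k, hk, ?_⟩
    simp only [hf, Nat.mod_eq_of_lt hk']
    exact List.getD_eq_getElem _ _ hk
  have hwin : ∀ i, ChainFromTo H (f i) (f (i + L - 1)) (seg f i (i + L)) := fun i =>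
    chainFromTo_seg (by omega) fun k _ _ => hadj k
  have hwS : ∀ i, ∀ x ∈ seg f i (i + L), x ∈ S := fun i x hx => by
    obtain ⟨k, -, -, rfl⟩ := mem_seg.1 hx
    exact hfS k
  set J := (Finset.range N).filter fun i => f (i + L - 1) ∈ nb H a₂
  have h3 : (nb H a₂ ∩ S).card ≤ J.card := by
    refine (Finset.card_le_card fun q hq => ?_).trans (Finset.card_image_le (s := J)
      (f := fun i => f (i + L - 1)))
    obtain ⟨hq, hqS⟩ := Finset.mem_inter.1 hq
    obtain ⟨k, hk, rfl⟩ := hsurj q hqS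
    have hper : ∀ j, f (j + N) = f j := fun j => by simp only [hf, Nat.add_mod_right]
    obtain ⟨i, hi, hik⟩ : ∃ i < N, f (i + L - 1) = f k := by
      rcases le_or_gt (L - 1) k with h | h
      · exact ⟨k - (L - 1), by omega, by congr 1; omega⟩
      · exact ⟨k + N - (L - 1), by omega, by rw [← hper k]; congr 1; omega⟩
    exact Finset.mem_image.2 ⟨i, Finset.mem_filter.2 ⟨Finset.mem_range.2 hi, hik ▸ hq⟩, hik⟩
  have h4 : (J.image f).card = J.card := Finset.card_image_of_injOn fun i hi j hj hij => by
    have h5 := hinj i j hij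
    have h6 := Finset.mem_range.1 (Finset.mem_filter.1 hi).1
    have h7 := Finset.mem_range.1 (Finset.mem_filter.1 hj).1
    rwa [Nat.mod_eq_of_lt h6, Nat.mod_eq_of_lt h7] at h5
  have h5 : J.image f ⊆ Z := by
    intro p hp
    obtain ⟨i, hi, rfl⟩ := Finset.mem_image.1 hp
    exact h₂ _ _ _ (hwin i) (by simp) (hwS i) (mem_nb.1 (Finset.mem_filter.1 hi).2)
  obtain ⟨p, hp⟩ : ((nb H a₁ ∩ S) ∩ J.image f).Nonempty := by
    rw [← Finset.card_pos]
    have := Finset.card_le_card (Finset.union_subset h₁ h5)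
    have := Finset.card_union_add_card_inter (nb H a₁ ∩ S) (J.image f)
    omega
  obtain ⟨hp1, hp2⟩ := Finset.mem_inter.1 hp
  obtain ⟨i, hi, rfl⟩ := Finset.mem_image.1 hp2
  refine ⟨_, _, _, hwin i, nodup_seg fun a ha ha' b hb hb' hab => ?_, hwS i, by simp,
    mem_nb.1 (Finset.mem_inter.1 hp1).1, mem_nb.1 (Finset.mem_filter.1 hi).2⟩
  have hmod := hinj a b hab
  rcases le_total a b with h | h
  · have := Nat.eq_zero_of_dvd_of_lt ((Nat.modEq_iff_dvd' h).1 hmod) (by omega)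
    omega
  · have := Nat.eq_zero_of_dvd_of_lt ((Nat.modEq_iff_dvd' h).1 hmod.symm) (by omega)
    omega

end Ham

section Bip

set_option linter.unusedSectionVars false

variable {V : Type*} [Fintype V] [DecidableEq V] {H : SimpleGraph V} {S T : Finset V}

theorem mem_right_of_between (hST : Disjoint S T) {x y : V} (h : (H.between S T).Adj x y)
    (hx : x ∈ S) : y ∈ T := by
  rcases h.2 with h | h
  · exact h.2
  · exact absurd h.1 (Finset.disjoint_left.1 hST hx)

theorem mem_left_of_between (hST : Disjoint S T) {x y : V} (h : (H.between S T).Adj x y)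
    (hx : x ∈ T) : y ∈ S := by
  rcases h.2 with h | h
  · exact absurd hx (Finset.disjoint_left.1 hST h.1)
  · exact h.2

/-- The ends of a chain alternating between `S` and `T` are determined by its parity. -/
theorem ChainFromTo.left_mem_of_between (hST : Disjoint S T) {u' : V} (hu' : u' ∈ T) :
    ∀ {w : List V} {u : V}, ChainFromTo (H.between S T) u u' w →
      (Odd w.length → u ∈ T) ∧ (Even w.length → u ∈ S)
  | [], _, h => absurd rfl h.ne_nil
  | [a], u, h => by
    have h1 := h.2.1
    have h2 := h.2.2
    simp at h1 h2
    exact ⟨fun _ => h1 ▸ h2 ▸ hu', fun h => by simp at h⟩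
  | a :: b :: w, u, h => by
    obtain ⟨hc, h1, h2⟩ := h
    obtain rfl : a = u := by simpa using h1
    have hc' := List.isChain_cons_cons.1 hc
    have ih := ChainFromTo.left_mem_of_between hST hu' (w := b :: w) (u := b)
      ⟨hc'.2, rfl, by simpa using h2⟩
    rw [List.length_cons, Nat.odd_add_one, Nat.even_add_one, Nat.not_odd_iff_even,
      Nat.not_even_iff_odd]
    exact ⟨fun h => mem_right_of_between hST hc'.1.symm (ih.2 h),
      fun h => mem_left_of_between hST hc'.1.symm (ih.1 h)⟩

theorem exists_isCyc_between (hST : Disjoint S T) (hcard : S.card = T.card) (hS : S.Nonempty) :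
    ∃ c, IsCyc ((⊤ : SimpleGraph V).between S T) c ∧ ∀ x, x ∈ c ↔ x ∈ S ∪ T := by
  obtain ⟨d, hd⟩ := hS
  have h0 : 0 < S.card := Finset.card_pos.2 ⟨d, hd⟩
  have hl₁ : S.toList.length = S.card := Finset.length_toList S
  have hl₂ : T.toList.length = S.card := by rw [Finset.length_toList, hcard]
  set f : ℕ → V := fun i =>
    if i % 2 = 0 then S.toList.getD (i / 2) d else T.toList.getD (i / 2) d with hf
  have hS' : ∀ i, i < 2 * S.card → i % 2 = 0 → f i ∈ S := fun i hi h => by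
    simp only [hf, h, if_true]
    rw [List.getD_eq_getElem _ _ (by omega)]
    exact Finset.mem_toList.1 (List.getElem_mem _)
  have hT' : ∀ i, i < 2 * S.card → i % 2 ≠ 0 → f i ∈ T := fun i hi h => by
    simp only [hf, h, if_false]
    rw [List.getD_eq_getElem _ _ (by omega)]
    exact Finset.mem_toList.1 (List.getElem_mem _)
  have hadj : ∀ i j, i < 2 * S.card → j < 2 * S.card → i % 2 = 0 → j % 2 ≠ 0 →
      ((⊤ : SimpleGraph V).between S T).Adj (f i) (f j) := fun i j hi hj h h' => by
    have h1 := hS' i hi h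
    have h2 := hT' j hj h'
    exact ⟨fun h => Finset.disjoint_left.1 hST h1 (h ▸ h2), Or.inl ⟨h1, h2⟩⟩
  refine ⟨seg f 0 (2 * S.card), ⟨nodup_seg fun a _ ha b _ hb hab => ?_, f 0, f (2 * S.card - 1),
    chainFromTo_seg (by omega) fun k _ hk => ?_, ?_⟩, fun x => ?_⟩
  · by_cases h1 : a % 2 = 0 <;> by_cases h2 : b % 2 = 0
    · simp only [hf, h1, h2, if_true] at hab
      rw [List.getD_eq_getElem _ _ (by omega), List.getD_eq_getElem _ _ (by omega),
        (Finset.nodup_toList S).getElem_inj_iff] at hab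
      omega
    · exact absurd (hab ▸ hS' a ha h1) (Finset.disjoint_right.1 hST (hT' b hb h2))
    · exact absurd (hab ▸ hT' a ha h1) (Finset.disjoint_left.1 hST (hS' b hb h2))
    · simp only [hf, h1, h2, if_false] at hab
      rw [List.getD_eq_getElem _ _ (by omega), List.getD_eq_getElem _ _ (by omega),
        (Finset.nodup_toList T).getElem_inj_iff] at hab
      omega
  · by_cases h : k % 2 = 0
    · exact hadj _ _ (by omega) hk h (by omega)
    · exact (hadj _ _ hk (by omega) (by omega) h).symm
  · exact (hadj _ _ (by omega) (by omega) (by omega) (by omega)).symm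
  · rw [mem_seg, Finset.mem_union]
    constructor
    · rintro ⟨k, -, hk, rfl⟩
      by_cases h : k % 2 = 0
      · exact Or.inl (hS' k hk h)
      · exact Or.inr (hT' k hk h)
    · rintro (h | h)
      · obtain ⟨k, hk, rfl⟩ := List.getElem_of_mem (Finset.mem_toList.2 h)
        refine ⟨2 * k, by omega, by omega, ?_⟩
        simp [hf, List.getElem?_eq_getElem hk]
      · obtain ⟨k, hk, rfl⟩ := List.getElem_of_mem (Finset.mem_toList.2 h)
        refine ⟨2 * k + 1, by omega, by omega, ?_⟩
        simp [hf, show (2 * k + 1) % 2 = 1 by omega, show (2 * k + 1) / 2 = k by omega,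
          List.getElem?_eq_getElem hk]

theorem hasCycleLength_of_bipartite {m N : ℕ} (hST : Disjoint S T) (hS : S.card = N + 1)
    (hT : T.card = N) (hdS : ∀ x ∈ S, N + 4 ≤ 2 * (nb H x ∩ T).card)
    (hdT : ∀ y ∈ T, N + 4 ≤ 2 * (nb H y ∩ S).card) (hm : Even m) (hm4 : 4 ≤ m)
    (hmN : m ≤ 2 * N) : HasCycleLength H m := by
  obtain ⟨s, hs⟩ : S.Nonempty := Finset.card_pos.1 (by omega)
  set S' := S.erase s with hS'
  have hcS' : S'.card = N := by rw [hS', Finset.card_erase_of_mem hs, hS]; omega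
  have hST' : Disjoint S' T := hST.mono_left (Finset.erase_subset _ _)
  have hsub : ∀ x, x ∈ S' ∪ T → x ∈ S ∨ x ∈ T := fun x hx =>
    (Finset.mem_union.1 hx).imp_left Finset.mem_of_mem_erase
  set B := H.between S T with hB
  have hdS' : ∀ x ∈ S, N + 4 ≤ 2 * (nb B x ∩ (S' ∪ T)).card := fun x hx =>
    (hdS x hx).trans <| Nat.mul_le_mul_left _ <| Finset.card_le_card fun y hy => by
      simp only [Finset.mem_inter, mem_nb, Finset.mem_union] at hy ⊢
      exact ⟨⟨hy.1, Or.inl ⟨hx, hy.2⟩⟩, Or.inr hy.2⟩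
  have hdT' : ∀ x ∈ T, N + 2 ≤ 2 * (nb B x ∩ (S' ∪ T)).card := fun x hx => by
    have h1 := hdT x hx
    have h2 : ((nb H x ∩ S).erase s).card ≤ (nb B x ∩ (S' ∪ T)).card :=
      Finset.card_le_card fun y hy => by
        simp only [Finset.mem_inter, mem_nb, Finset.mem_union, Finset.mem_erase, hS'] at hy ⊢
        exact ⟨⟨hy.2.1, Or.inr ⟨hx, hy.2.2⟩⟩, Or.inl ⟨hy.1, hy.2.2⟩⟩
    have h3 := Finset.pred_card_le_card_erase (s := nb H x ∩ S) (a := s)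
    omega
  obtain ⟨c₀, hc₀, hc₀S⟩ := exists_isCyc_between hST' (by omega) (Finset.card_pos.1 (by omega))
  have hmono : (⊤ : SimpleGraph V).between S' T ≤ (⊤ : SimpleGraph V).between S T := by
    rintro a b ⟨h, h'⟩
    exact ⟨h, h'.imp (.imp_left Finset.mem_of_mem_erase) (.imp_right Finset.mem_of_mem_erase)⟩
  have hBK : B ≤ (⊤ : SimpleGraph V).between S T := fun a b h => ⟨h.1.ne, h.2⟩
  have hcST : (S' ∪ T).card = 2 * N := by rw [Finset.card_union_of_disjoint hST']; omega
  obtain ⟨c, hc, hcS⟩ := exists_isCyc_of_card_lt hBK (hc₀.mono hmono) hc₀S (by omega)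
    (fun x hx y hy hxy => by
      rcases hsub x hx with h | h
      · have hyT := mem_right_of_between hST hxy h
        have := hdS' x h
        have := hdT' y hyT
        refine ⟨T, by omega, fun z hz => ?_, fun p _ q _ hpq hyq => ?_⟩
        · exact mem_right_of_between hST (mem_nb.1 (Finset.mem_inter.1 hz).1) h
        · exact mem_right_of_between hST hpq.symm (mem_left_of_between hST hyq hyT)
      · have hyS := mem_left_of_between hST hxy h
        have := hdS' y hyS
        have := hdT' x h
        refine ⟨S, by omega, fun z hz => ?_, fun p _ q _ hpq hyq => ?_⟩
        · exact mem_left_of_between hST (mem_nb.1 (Finset.mem_inter.1 hz).1) h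
        · exact mem_left_of_between hST hpq.symm (mem_right_of_between hST hyq hyS))
  have hds := hdS' s hs
  obtain ⟨u, u', w, hw, hwn, hwS, hwl, hu, hu'⟩ := hc.exists_window hcS (a₁ := s) (a₂ := s)
    (L := m - 1) (by omega) (by omega) (Z := T) (by omega)
    (fun z hz => mem_right_of_between hST (mem_nb.1 (Finset.mem_inter.1 hz).1) hs)
    (fun u u' w hw hwl _ hu' => by
      refine (hw.left_mem_of_between hST (mem_right_of_between hST hu' hs)).1 ?_
      rw [hwl]
      exact Nat.Even.sub_odd (by omega) hm odd_one)
  have hsw : s ∉ w := fun h => by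
    rcases Finset.mem_union.1 (hwS s h) with h | h
    · exact absurd rfl (Finset.ne_of_mem_erase h)
    · exact Finset.disjoint_left.1 hST hs h
  have hcyc : IsCyc H (s :: w) := ⟨List.nodup_cons.2 ⟨hsw, hwn⟩, s, u',
    (hw.cons hu).mono between_le, hu'.1.symm⟩
  have hl : (s :: w).length = m := by rw [List.length_cons, hwl]; omega
  exact hl ▸ hcyc.hasCycleLength (by omega)

end Bip

section Cluster

set_option linter.unusedSectionVars false

variable {V : Type*} [Fintype V] [DecidableEq V] {H : SimpleGraph V} {n : ℕ}

/-- If any two vertices of `S` cover almost all of `T`, all but two of them are adjacent to more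
than half of `T`. -/
theorem exists_card_le_two {S T : Finset V} {q : ℕ}
    (hq : ∀ a ∈ S, ∀ a' ∈ S, a ≠ a' → (T \ (nb H a ∪ nb H a')).card ≤ q)
    (hT : 1800 + 6 * q ≤ T.card) :
    ∃ B ⊆ S, B.card ≤ 2 ∧ ∀ a ∈ S \ B, T.card + 600 ≤ 2 * (nb H a ∩ T).card := by
  refine ⟨S.filter fun a => 2 * (nb H a ∩ T).card < T.card + 600, Finset.filter_subset _ _, ?_,
    fun a ha => ?_⟩
  · by_contra! h
    obtain ⟨a, b, c, ha, hb, hc, hab, hac, hbc⟩ := Finset.two_lt_card_iff.1 h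
    obtain ⟨haS, ha⟩ := Finset.mem_filter.1 ha
    obtain ⟨hbS, hb⟩ := Finset.mem_filter.1 hb
    obtain ⟨hcS, hc⟩ := Finset.mem_filter.1 hc
    have hcard : ∀ z, (T \ nb H z).card + (nb H z ∩ T).card = T.card := fun z => by
      rw [Finset.inter_comm, Finset.card_sdiff_add_card_inter]
    have hinter : ∀ z z', (T \ nb H z) ∩ (T \ nb H z') = T \ (nb H z ∪ nb H z') := fun z z' => by
      rw [← Finset.sdiff_union_distrib]
    have h1 := Finset.card_union_add_card_inter (T \ nb H a) (T \ nb H b)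
    have h2 := Finset.card_union_add_card_inter (T \ nb H a ∪ T \ nb H b) (T \ nb H c)
    rw [Finset.union_inter_distrib_right, hinter, hinter] at h2
    rw [hinter] at h1
    have h3 := Finset.card_union_le (T \ (nb H a ∪ nb H c)) (T \ (nb H b ∪ nb H c))
    have h4 : (T \ nb H a ∪ T \ nb H b ∪ T \ nb H c).card ≤ T.card := Finset.card_le_card
      (Finset.union_subset (Finset.union_subset Finset.sdiff_subset Finset.sdiff_subset)
        Finset.sdiff_subset)
    have := hcard a
    have := hcard b
    have := hcard c
    have := hq a haS b hbS hab
    have := hq a haS c hcS hac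
    have := hq b hbS c hcS hbc
    omega
  · obtain ⟨haS, ha⟩ := Finset.mem_sdiff.1 ha
    by_contra! h
    exact ha (Finset.mem_filter.2 ⟨haS, h⟩)

theorem PairDense.card_sdiff_add_card_le (hH : PairDense H n) {T C : Finset V}
    (hTC : Disjoint T C) {a a' : V} (haa : a ≠ a') (ha : (nb H a ∩ C).card ≤ 1)
    (ha' : (nb H a' ∩ C).card ≤ 1) : (T \ (nb H a ∪ nb H a')).card + C.card ≤ n + 3 := by
  have h1 := hH.card_union haa
  have h2 : T \ (nb H a ∪ nb H a') ∪ C \ (nb H a ∪ nb H a') ⊆ (nb H a ∪ nb H a')ᶜ := by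
    rw [← Finset.union_sdiff_distrib]
    exact fun z hz => Finset.mem_compl.2 (Finset.mem_sdiff.1 hz).2
  have h3 := Finset.card_le_card h2
  rw [Finset.card_union_of_disjoint (hTC.mono Finset.sdiff_subset Finset.sdiff_subset),
    Finset.card_compl, hH.1] at h3
  have h4 := Finset.card_sdiff_add_card_inter C (nb H a ∪ nb H a')
  rw [Finset.inter_comm, Finset.union_inter_distrib_right] at h4
  have h5 := Finset.card_union_le (nb H a ∩ C) (nb H a' ∩ C)
  omega

/-- Two vertices attached to a dense cluster are joined through it by paths of all moderate
lengths. -/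
theorem exists_chain_of_cluster {A : Finset V}
    (hA : ∀ a ∈ A, A.card + 20 ≤ 2 * (nb H a ∩ A).card) {x₁ x₂ : V} (hx : x₁ ≠ x₂)
    (h₁ : 4 ≤ (nb H x₁ ∩ A).card) (h₂ : 4 ≤ (nb H x₂ ∩ A).card) {i : ℕ} (hi : 5 ≤ i)
    (hi' : i ≤ A.card) (hA' : 7 ≤ A.card) :
    ∃ l, ChainFromTo H x₁ x₂ l ∧ l.Nodup ∧ l.length = i ∧ ∀ z ∈ l, z = x₁ ∨ z = x₂ ∨ z ∈ A := by
  obtain ⟨g, hg, hgA⟩ := exists_injective_choice 2 ![nb H x₁ ∩ A, nb H x₂ ∩ A] {x₁, x₂} (by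
    intro j
    have := Finset.card_le_two (a := x₁) (b := x₂)
    fin_cases j <;> simp <;> omega)
  obtain ⟨⟨ha₁, ha₁A⟩, ha₁x₁, ha₁x₂⟩ : (H.Adj x₁ (g 0) ∧ g 0 ∈ A) ∧ g 0 ≠ x₁ ∧ g 0 ≠ x₂ := by
    simpa using hgA 0
  obtain ⟨⟨ha₂, ha₂A⟩, ha₂x₁, ha₂x₂⟩ : (H.Adj x₂ (g 1) ∧ g 1 ∈ A) ∧ g 1 ≠ x₁ ∧ g 1 ≠ x₂ := by
    simpa using hgA 1
  have ha : g 0 ≠ g 1 := fun h => by simpa using hg h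
  generalize g 0 = a₁ at *
  generalize g 1 = a₂ at *
  set E : Finset V := {x₁, x₂, a₁, a₂} with hE
  have hE4 : E.card ≤ 4 := Finset.card_le_four
  have hcard := Finset.card_sdiff_add_card_inter A E
  have hcard' := Finset.card_le_card (Finset.inter_subset_right (s₁ := A) (s₂ := E))
  have hdeg : ∀ a ∈ A, (A \ E).card < 2 * (nb H a ∩ (A \ E)).card := fun a ha => by
    have h1 := hA a ha
    have h2 := Finset.card_sdiff_add_card_inter (nb H a ∩ A) E
    have h3 := Finset.card_le_card (Finset.inter_subset_right (s₁ := nb H a ∩ A) (s₂ := E))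
    rw [Finset.inter_sdiff_assoc] at h2
    omega
  obtain ⟨z, hz⟩ : (A \ E).Nonempty := Finset.card_pos.1 (by omega)
  have hne : (A \ E).toList ≠ [] := by
    rw [Ne, Finset.toList_eq_nil]
    exact Finset.ne_empty_of_mem hz
  obtain ⟨c, hc, hcS⟩ := exists_isCyc_of_card_lt (H := H) (K := ⊤) (S := A \ E) le_top
    (c₀ := (A \ E).toList) ⟨Finset.nodup_toList _, _, _, ChainFromTo.of_isChain
      ((Finset.nodup_toList (A \ E)).isChain.imp fun _ _ h => h) hne, fun h => by
        rw [List.getLast_eq_getElem, List.head_eq_getElem,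
          (Finset.nodup_toList _).getElem_inj_iff, Finset.length_toList] at h
        omega⟩
    (fun x => Finset.mem_toList) (by omega) (fun x hx y hy _ => by
      have := hdeg x (Finset.mem_sdiff.1 hx).1
      have := hdeg y (Finset.mem_sdiff.1 hy).1
      exact ⟨A \ E, by omega, Finset.inter_subset_right, fun p hp _ _ _ _ => hp⟩)
  have h1 := hdeg a₁ ha₁A
  have h2 := hdeg a₂ ha₂A
  obtain ⟨u, u', w, hw, hwn, hwS, hwl, hu, hu'⟩ := hc.exists_window hcS (a₁ := a₁) (a₂ := a₂)
    (L := i - 4) (by omega) (by omega) (Z := A \ E) (by omega) Finset.inter_subset_right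
    (fun u u' w hw _ hwS _ => hwS u hw.left_mem)
  have hwE : ∀ z ∈ w, z ∈ A ∧ z ≠ x₁ ∧ z ≠ x₂ ∧ z ≠ a₁ ∧ z ≠ a₂ := fun z hz => by
    simpa [hE] using hwS z hz
  refine ⟨x₁ :: a₁ :: (w ++ [a₂, x₂]), ?_, ?_, ?_, ?_⟩
  · exact ((hw.append ((ChainFromTo.single H x₂).cons ha₂.symm) hu'.symm).cons hu).cons ha₁
  · have e1 : x₁ ∉ w := fun h => (hwE _ h).2.1 rfl
    have e2 : x₂ ∉ w := fun h => (hwE _ h).2.2.1 rfl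
    have e3 : a₁ ∉ w := fun h => (hwE _ h).2.2.2.1 rfl
    have e4 : a₂ ∉ w := fun h => (hwE _ h).2.2.2.2 rfl
    simp only [List.nodup_cons, List.mem_cons, List.mem_append, List.nodup_append]
    grind
  · simp [hwl]
    omega
  · intro z hz
    have := hwE z
    grind

end Cluster

section Cross

set_option linter.unusedSectionVars false

variable {V : Type*} [Fintype V] [DecidableEq V] {H : SimpleGraph V} {n : ℕ}

theorem PairDense.exists_crossing_ne (hH : PairDense H n) {P : Finset V} (hP : 3 ≤ P.card)
    (hP' : 3 ≤ Pᶜ.card) (w : V) : ∃ x ∈ P, ∃ y ∉ P, H.Adj x y ∧ x ≠ w ∧ y ≠ w := by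
  by_contra! hno
  have key : ∀ Q : Finset V, 3 ≤ Q.card → (∀ x ∈ Q, x ≠ w → ∀ y, H.Adj x y → y ∈ insert w Q) →
      n + 1 ≤ (insert w Q).card := by
    intro Q hQ hcl
    obtain ⟨u, hu, u', hu', huu⟩ := Finset.one_lt_card.1
      (show 1 < (Q.erase w).card by have := Finset.pred_card_le_card_erase (s := Q) (a := w); omega)
    obtain ⟨h1, h2⟩ := Finset.mem_erase.1 hu
    obtain ⟨h3, h4⟩ := Finset.mem_erase.1 hu'
    refine (hH.2 u u' huu).trans (Finset.card_le_card fun z hz => ?_)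
    simp only [Finset.mem_insert, Finset.mem_union, mem_nb] at hz
    rcases hz with rfl | rfl | hz | hz
    · exact Finset.mem_insert_of_mem h2
    · exact Finset.mem_insert_of_mem h4
    · exact hcl _ h2 h1 _ hz
    · exact hcl _ h4 h3 _ hz
  have h1 := key P hP fun x hx hxw y hxy => by
    by_contra h
    rw [Finset.mem_insert, not_or] at h
    exact h.1 (hno x hx y h.2 hxy hxw)
  have h2 := key Pᶜ hP' fun x hx hxw y hxy => by
    by_contra h
    rw [Finset.mem_insert, not_or, Finset.mem_compl, not_not] at h
    exact hxw (hno y h.2 x (Finset.mem_compl.1 hx) hxy.symm h.1)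
  have h3 := Finset.card_union_add_card_inter (insert w P) (insert w Pᶜ)
  have h4 : insert w P ∩ insert w Pᶜ = {w} := by
    rw [← Finset.insert_inter_distrib, Finset.inter_compl, insert_empty_eq]
  have h5 := Finset.card_le_univ (insert w P ∪ insert w Pᶜ)
  rw [h4, Finset.card_singleton] at h3
  rw [hH.1] at h5
  omega

theorem PairDense.exists_disjoint_crossing (hH : PairDense H n) {P : Finset V} (hP : 3 ≤ P.card)
    (hP' : 3 ≤ Pᶜ.card) : ∃ x₁ ∈ P, ∃ x₂ ∈ P, ∃ y₁ ∉ P, ∃ y₂ ∉ P, x₁ ≠ x₂ ∧ y₁ ≠ y₂ ∧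
      H.Adj x₁ y₁ ∧ H.Adj x₂ y₂ := by
  obtain ⟨v₀, -⟩ : P.Nonempty := Finset.card_pos.1 (by omega)
  obtain ⟨x, hx, y, hy, hxy, -⟩ := hH.exists_crossing_ne hP hP' v₀
  obtain ⟨a, ha, b, hb, hab, hax, hbx⟩ := hH.exists_crossing_ne hP hP' x
  by_cases hby : y = b
  · subst hby
    obtain ⟨e, he, f, hf, hef, hey, hfy⟩ := hH.exists_crossing_ne hP hP' y
    by_cases hex : e = x
    · exact ⟨a, ha, e, he, y, hy, f, hf, hex ▸ hax, hfy.symm, hab, hef⟩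
    · exact ⟨x, hx, e, he, y, hy, f, hf, Ne.symm hex, hfy.symm, hxy, hef⟩
  · exact ⟨x, hx, a, ha, y, hy, b, hb, hax.symm, hby, hxy, hab⟩

/-- Two disjoint connections between `P` and `Q`, one of which may pass through the single vertex
`v` outside of both. -/
theorem PairDense.exists_connections (hH : PairDense H n) {P Q : Finset V} {v : V}
    (hPQ : ∀ z, z ∈ Q ↔ z ∉ P ∧ z ≠ v) (hvP : v ∉ P) (hP : 3 ≤ P.card) (hQ : 3 ≤ Q.card) :
    ∃ x₁ ∈ P, ∃ x₂ ∈ P, ∃ y₁ ∈ Q, ∃ y₂ ∈ Q, x₁ ≠ x₂ ∧ y₁ ≠ y₂ ∧ H.Adj x₂ y₂ ∧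
      (H.Adj x₁ y₁ ∨ H.Adj x₁ v ∧ H.Adj v y₁) := by
  have hvQ : v ∉ Q := fun h => ((hPQ v).1 h).2 rfl
  have e1 : Pᶜ = insert v Q := by
    ext z
    by_cases h : z = v
    · simp [h, hvP]
    · simp [h, hPQ]
  have e2 : (insert v P)ᶜ = Q := by
    ext z
    simp [hPQ, and_comm]
  obtain ⟨x₁, hx₁, x₂, hx₂, y₁, hy₁, y₂, hy₂, hx, hy, h₁, h₂⟩ := hH.exists_disjoint_crossing hP
    (by rw [e1]; exact hQ.trans (Finset.card_le_card (Finset.subset_insert _ _)))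
  obtain ⟨a₁, ha₁, a₂, ha₂, b₁, hb₁, b₂, hb₂, ha, hb, k₁, k₂⟩ :=
    hH.exists_disjoint_crossing (P := insert v P)
      (hP.trans (Finset.card_le_card (Finset.subset_insert _ _))) (by rwa [e2])
  rw [← Finset.mem_compl, e1, Finset.mem_insert] at hy₁ hy₂
  rw [← Finset.mem_compl, e2] at hb₁ hb₂
  rw [Finset.mem_insert] at ha₁ ha₂
  by_contra! hno
  have hdir : ∀ x ∈ P, ∀ p ∈ P, ∀ y ∈ Q, ∀ q ∈ Q, x ≠ p → y ≠ q → H.Adj p q → ¬ H.Adj x y :=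
    fun x hx p hp y hy q hq hxp hyq hpq => (hno x hx p hp y hy q hq hxp hyq hpq).1
  have hvia : ∀ x ∈ P, ∀ p ∈ P, ∀ y ∈ Q, ∀ q ∈ Q, x ≠ p → y ≠ q → H.Adj p q → H.Adj x v →
      ¬ H.Adj v y :=
    fun x hx p hp y hy q hq hxp hyq hpq => (hno x hx p hp y hy q hq hxp hyq hpq).2
  obtain ⟨x, hxP, p, hpP, q, hqQ, hxp, hxv, hpq⟩ :
      ∃ x ∈ P, ∃ p ∈ P, ∃ q ∈ Q, x ≠ p ∧ H.Adj x v ∧ H.Adj p q := by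
    rcases hy₁ with rfl | hy₁
    · exact ⟨x₁, hx₁, x₂, hx₂, y₂, hy₂.resolve_left hy.symm, hx, h₁, h₂⟩
    rcases hy₂ with rfl | hy₂
    · exact ⟨x₂, hx₂, x₁, hx₁, y₁, hy₁, hx.symm, h₂, h₁⟩
    · exact absurd h₁ (hdir x₁ hx₁ x₂ hx₂ y₁ hy₁ y₂ hy₂ hx hy h₂)
  obtain ⟨y, hyQ, s, hsQ, r, hrP, hys, hvy, hrs⟩ :
      ∃ y ∈ Q, ∃ s ∈ Q, ∃ r ∈ P, y ≠ s ∧ H.Adj v y ∧ H.Adj r s := by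
    rcases ha₁ with rfl | ha₁
    · exact ⟨b₁, hb₁, b₂, hb₂, a₂, ha₂.resolve_left ha.symm, hb, k₁, k₂⟩
    rcases ha₂ with rfl | ha₂
    · exact ⟨b₂, hb₂, b₁, hb₁, a₁, ha₁, hb.symm, k₂, k₁⟩
    · exact absurd k₁ (hdir a₁ ha₁ a₂ ha₂ b₁ hb₁ b₂ hb₂ ha hb k₂)
  by_cases hyq : y = q
  · by_cases hxr : x = r
    · exact hdir r hrP p hpP s hsQ q hqQ (hxr ▸ hxp) (hyq ▸ hys.symm) hpq hrs
    · exact hvia x hxP r hrP y hyQ s hsQ hxr hys hrs hxv hvy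
  · exact hvia x hxP p hpP y hyQ q hqQ hxp hyq hpq hxv hvy

end Cross

section Fin

set_option linter.unusedSectionVars false

variable {V : Type*} [Fintype V] [DecidableEq V] {H : SimpleGraph V} {n m : ℕ}

/-- After deleting two vertices, `A` is a cluster in which every vertex sees more than half. -/
theorem PairDense.exists_cluster (hH : PairDense H n) (hn : 4511 ≤ n) {A C : Finset V}
    (hAC : Disjoint A C) (hA : n ≤ A.card + 313) (hC : n ≤ C.card + 313)
    (hAC₁ : ∀ a ∈ A, (nb H a ∩ C).card ≤ 1) :
    ∃ A' ⊆ A, A.card ≤ A'.card + 2 ∧ ∀ a ∈ A', A'.card + 20 ≤ 2 * (nb H a ∩ A').card := by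
  obtain ⟨B, hBA, hB, hdeg⟩ := exists_card_le_two (H := H) (S := A) (T := A) (q := 316)
    (fun a ha a' ha' haa => by
      have := hH.card_sdiff_add_card_le hAC haa (hAC₁ a ha) (hAC₁ a' ha')
      omega) (by omega)
  have hcard := Finset.card_sdiff_add_card_eq_card hBA
  refine ⟨A \ B, Finset.sdiff_subset, by omega, fun a ha => ?_⟩
  have h1 := hdeg a ha
  have h2 := Finset.card_sdiff_add_card_inter (nb H a ∩ A) B
  have h3 := Finset.card_le_card (Finset.inter_subset_right (s₁ := nb H a ∩ A) (s₂ := B))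
  rw [Finset.inter_sdiff_assoc] at h2
  omega

theorem PairDense.hasCycleLength_of_clusters (hH : PairDense H n) (hn : 4511 ≤ n) (hm : Even m)
    (hm1 : n + 1 ≤ m) (hm2 : m ≤ 2 * n - 4008) {A C : Finset V} (hAC : Disjoint A C)
    (hA : n ≤ A.card + 312) (hC : n ≤ C.card + 312) (hAC₁ : ∀ a ∈ A, (nb H a ∩ C).card ≤ 1)
    (hCA₁ : ∀ x ∈ C, (nb H x ∩ A).card ≤ 1) : HasCycleLength H m := by
  obtain ⟨v, hv⟩ := hH.exists_exceptional (by omega)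
  have hmono : ∀ {S T : Finset V} (x : V), (nb H x ∩ S).card ≤ 1 → T ⊆ S → (nb H x ∩ T).card ≤ 1 :=
    fun x h hTS => (Finset.card_le_card (Finset.inter_subset_inter_left hTS)).trans h
  have hAe := Finset.pred_card_le_card_erase (s := A) (a := v)
  have hCe := Finset.pred_card_le_card_erase (s := C) (a := v)
  obtain ⟨A', hA', hcA, hdA⟩ := hH.exists_cluster hn (A := A.erase v) (C := C.erase v)
    (hAC.mono (Finset.erase_subset _ _) (Finset.erase_subset _ _)) (by omega) (by omega)
    fun a ha => hmono a (hAC₁ a (Finset.mem_of_mem_erase ha)) (Finset.erase_subset _ _)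
  obtain ⟨C', hC', hcC, hdC⟩ := hH.exists_cluster hn (A := C.erase v) (C := A.erase v)
    (hAC.symm.mono (Finset.erase_subset _ _) (Finset.erase_subset _ _)) (by omega) (by omega)
    fun a ha => hmono a (hCA₁ a (Finset.mem_of_mem_erase ha)) (Finset.erase_subset _ _)
  have hvA : v ∉ A' := fun h => Finset.notMem_erase v A (hA' h)
  have hvC : v ∉ C' := fun h => Finset.notMem_erase v C (hC' h)
  have hdisj : Disjoint A' C' := hAC.mono (hA'.trans (Finset.erase_subset _ _))
    (hC'.trans (Finset.erase_subset _ _))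
  have hdeg : ∀ u, u ≠ v → 4 ≤ (nb H u ∩ A').card ∨ 4 ≤ (nb H u ∩ C').card := fun u hu => by
    by_contra! h
    have h1 := hv u hu
    have h2 := Finset.card_sdiff_add_card_inter (nb H u) (A' ∪ C')
    have h3 := Finset.card_le_card (show nb H u \ (A' ∪ C') ⊆ (A' ∪ C')ᶜ from fun z hz =>
      Finset.mem_compl.2 (Finset.mem_sdiff.1 hz).2)
    rw [Finset.card_compl, hH.1, Finset.card_union_of_disjoint hdisj] at h3
    rw [Finset.inter_union_distrib_left] at h2
    have h4 := Finset.card_union_le (nb H u ∩ A') (nb H u ∩ C')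
    omega
  set P := Finset.univ.filter fun u => u ≠ v ∧ (u ∈ A' ∨ u ∉ C' ∧ 4 ≤ (nb H u ∩ A').card)
  set Q := Finset.univ.filter fun u => u ∉ P ∧ u ≠ v
  have hP : ∀ u ∈ P, 4 ≤ (nb H u ∩ A').card := fun u hu => by
    obtain ⟨-, -, h | h⟩ := Finset.mem_filter.1 hu
    · have := hdA u h
      omega
    · exact h.2
  have hQ : ∀ u ∈ Q, 4 ≤ (nb H u ∩ C').card := fun u hu => by
    obtain ⟨-, h, huv⟩ := Finset.mem_filter.1 hu
    by_cases huC : u ∈ C'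
    · have := hdC u huC
      omega
    · refine (hdeg u huv).resolve_left fun h' => h (Finset.mem_filter.2 ⟨Finset.mem_univ _, huv,
        Or.inr ⟨huC, h'⟩⟩)
  have hAP : A' ⊆ P := fun u hu => Finset.mem_filter.2
    ⟨Finset.mem_univ _, fun h => hvA (h ▸ hu), Or.inl hu⟩
  have hCQ : C' ⊆ Q := fun u hu => Finset.mem_filter.2
    ⟨Finset.mem_univ _, fun h => by
      obtain ⟨-, -, h | h⟩ := Finset.mem_filter.1 h
      · exact Finset.disjoint_left.1 hdisj h hu
      · exact h.1 hu, fun h => hvC (h ▸ hu)⟩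
  have hvP : v ∉ P := fun h => (Finset.mem_filter.1 h).2.1 rfl
  have hvQ : v ∉ Q := fun h => (Finset.mem_filter.1 h).2.2 rfl
  have hPQ : ∀ z ∈ P, z ∉ Q := fun z h h' => (Finset.mem_filter.1 h').2.1 h
  have hcP := Finset.card_le_card hAP
  have hcQ := Finset.card_le_card hCQ
  obtain ⟨x₁, hx₁, x₂, hx₂, y₁, hy₁, y₂, hy₂, hx, hy, hxy₂, hxy₁⟩ :=
    hH.exists_connections (P := P) (Q := Q) (v := v) (by simp [Q]) hvP (by omega) (by omega)
  obtain ⟨k, hk⟩ := hm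
  have hlen : ∀ i j, 5 ≤ i → 5 ≤ j → i ≤ k → j ≤ k → ∃ l, ChainFromTo H x₁ y₁ l ∧ l.Nodup ∧
      l.length = i + j ∧ v ∉ l := by
    intro i j hi hj hik hjk
    obtain ⟨l, hl, hln, hli, hlA⟩ := exists_chain_of_cluster hdA hx (hP _ hx₁) (hP _ hx₂) hi
      (by omega) (by omega)
    obtain ⟨l', hl', hln', hlj, hlC⟩ := exists_chain_of_cluster hdC hy.symm (hQ _ hy₂) (hQ _ hy₁)
      hj (by omega) (by omega)
    have hlP : ∀ z ∈ l, z ∈ P := fun z hz => by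
      rcases hlA z hz with rfl | rfl | h
      exacts [hx₁, hx₂, hAP h]
    have hlQ : ∀ z ∈ l', z ∈ Q := fun z hz => by
      rcases hlC z hz with rfl | rfl | h
      exacts [hy₂, hy₁, hCQ h]
    refine ⟨l ++ l', hl.append hl' hxy₂, List.nodup_append'.2 ⟨hln, hln', fun z hz hz' =>
      hPQ z (hlP z hz) (hlQ z hz')⟩, by simp [hli, hlj], fun h => ?_⟩
    rcases List.mem_append.1 h with h | h
    · exact hvP (hlP v h)
    · exact hvQ (hlQ v h)
  rcases hxy₁ with h | ⟨h, h'⟩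
  · obtain ⟨l, hl, hln, hll, -⟩ := hlen k k (by omega) (by omega) le_rfl le_rfl
    have hcyc : IsCyc H l := ⟨hln, _, _, hl, h.symm⟩
    rw [hk, ← hll]
    exact hcyc.hasCycleLength (by omega)
  · obtain ⟨l, hl, hln, hll, hvl⟩ := hlen k (k - 1) (by omega) (by omega) le_rfl (by omega)
    have hcyc : IsCyc H (v :: l) := ⟨List.nodup_cons.2 ⟨hvl, hln⟩, _, _, hl.cons h.symm, h'.symm⟩
    have hl' : (v :: l).length = m := by rw [List.length_cons, hll]; omega
    exact hl' ▸ hcyc.hasCycleLength (by omega)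

theorem HasSparsePairs.hasCycleLength {X Y C₀ C₁ : Finset V} (h : HasSparsePairs H n X Y C₀ C₁)
    (hH : PairDense H n) (hn : 4511 ≤ n) (hm : Even m) (hm1 : n + 1 ≤ m)
    (hm2 : m ≤ 2 * n - 4008) : HasCycleLength H m := by
  have hX := h.card_X
  have hY := h.card_Y
  have hC₀ := h.card_C₀
  have hC₁ := h.card_C₁
  by_cases hXY : 1 < (X ∩ Y).card
  · obtain ⟨x, hx, x', hx', hxx⟩ := Finset.one_lt_card.1 hXY
    obtain ⟨hxX, hxY⟩ := Finset.mem_inter.1 hx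
    obtain ⟨hxX', hxY'⟩ := Finset.mem_inter.1 hx'
    have hle : ∀ z ∈ X, z ∈ Y → (nb H z ∩ (C₀ ∪ C₁)).card ≤ 2 := fun z hzX hzY => by
      rw [Finset.inter_union_distrib_left]
      have := Finset.card_union_le (nb H z ∩ C₀) (nb H z ∩ C₁)
      have := h.right_X z hzX
      have := h.right_Y z hzY
      omega
    have h1 := hH.card_union hxx
    have h2 := Finset.card_union_add_card_inter (nb H x ∪ nb H x') (C₀ ∪ C₁)
    rw [Finset.union_inter_distrib_right] at h2
    have h3 := Finset.card_union_le (nb H x ∩ (C₀ ∪ C₁)) (nb H x' ∩ (C₀ ∪ C₁))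
    have h4 := hle x hxX hxY
    have h5 := hle x' hxX' hxY'
    have h6 := Finset.card_le_univ (nb H x ∪ nb H x' ∪ (C₀ ∪ C₁))
    rw [hH.1] at h6
    have h7 := Finset.card_union_add_card_inter C₀ C₁
    refine hH.hasCycleLength_of_clusters hn hm hm1 hm2 (A := X) (C := C₀ ∩ C₁)
      (h.disjoint_X.mono_right Finset.inter_subset_right) (by omega) (by omega) (fun a ha => ?_)
      (fun z hz => h.left_X z (Finset.mem_inter.1 hz).1)
    exact (Finset.card_le_card (Finset.inter_subset_inter_left Finset.inter_subset_left)).trans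
      (h.right_X a ha)
  · have hXc : X.card + C₁.card ≤ 2 * n := by
      have := Finset.card_le_univ (X ∪ C₁)
      rwa [hH.1, Finset.card_union_of_disjoint h.disjoint_X] at this
    have hYc : Y.card + C₀.card ≤ 2 * n := by
      have := Finset.card_le_univ (Y ∪ C₀)
      rwa [hH.1, Finset.card_union_of_disjoint h.disjoint_Y] at this
    have hS := Finset.card_sdiff_add_card_inter X Y
    set S := X \ Y with hSdef
    have hSX : S ⊆ X := Finset.sdiff_subset
    obtain ⟨B, hBS, hB, hdS⟩ := exists_card_le_two (H := H) (S := S) (T := Y) (q := 160)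
      (fun a ha a' ha' haa => by
        have := hH.card_sdiff_add_card_le h.disjoint_Y haa (h.right_X a (hSX ha))
          (h.right_X a' (hSX ha'))
        omega) (by omega)
    obtain ⟨B', hBY, hB', hdY⟩ := exists_card_le_two (H := H) (S := Y) (T := S) (q := 160)
      (fun a ha a' ha' haa => by
        have := hH.card_sdiff_add_card_le (h.disjoint_X.mono_left hSX) haa (h.right_Y a ha)
          (h.right_Y a' ha')
        omega) (by omega)
    have hcS := Finset.card_sdiff_add_card_eq_card hBS
    have hcY := Finset.card_sdiff_add_card_eq_card hBY
    obtain ⟨S', hS', hcS'⟩ := Finset.exists_subset_card_eq (s := S \ B) (n := n - 140 + 1)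
      (by omega)
    obtain ⟨T', hT', hcT'⟩ := Finset.exists_subset_card_eq (s := Y \ B') (n := n - 140) (by omega)
    have hdrop : ∀ (x : V) {T T₀ : Finset V}, T₀ ⊆ T →
        (nb H x ∩ T).card + T₀.card ≤ (nb H x ∩ T₀).card + T.card := fun x T T₀ hT => by
      have h1 := Finset.card_union_add_card_inter (nb H x ∩ T) T₀
      have h2 := Finset.card_le_card (Finset.union_subset Finset.inter_subset_right hT :
        nb H x ∩ T ∪ T₀ ⊆ T)
      rw [Finset.inter_assoc, Finset.inter_eq_right.2 hT] at h1
      omega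
    refine hasCycleLength_of_bipartite (S := S') (T := T') (N := n - 140)
      ((Finset.sdiff_disjoint (s := Y) (t := X)).mono (hS'.trans Finset.sdiff_subset)
        (hT'.trans Finset.sdiff_subset)) hcS' hcT' (fun x hx => ?_) (fun y hy => ?_) hm (by omega)
      (by omega)
    · have := hdS x (hS' hx)
      have := hdrop x (hT'.trans Finset.sdiff_subset)
      omega
    · have := hdY y (hT' hy)
      have := hdrop y (hS'.trans Finset.sdiff_subset)
      omega

end Fin

theorem stmt_11 {V : Type*} [Fintype V] [DecidableEq V] (G : SimpleGraph V) [DecidableRel G.Adj]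
    (n m : ℕ) (hn : 4511 ≤ n) (hcard : Fintype.card V = 2 * n)
    (hm : Even m) (hm1 : n + 1 ≤ m) (hm2 : m ≤ 2 * n - 4008)
    (hG : ¬ Contains G (completeBipartiteGraph (Fin 2) (Fin n)))
    (hGc : ¬ HasCycleLength Gᶜ m) :
    ∀ v, (n + 1) / 2 + 250 ≤ Gᶜ.degree v := by
  have hH := pairDense_compl hcard hG
  rcases hH.hasCycleLength_or_exists_sparsePairs hn hm hm1 hm2 with h | ⟨X, Y, C₀, C₁, h⟩
  · exact absurd h hGc
  · exact absurd (h.hasCycleLength hH hn hm hm1 hm2) hGc
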